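/- arXiv:1610.00781 — 2 statements merged into one kernel-verified Lean document; each statement's English description precedes it below -/
import Mathlib

section
/- Consider multi-step SLA: the Metropolis–Hastings algorithm with target π_d (dπ_d/dπ̃_d = exp(−φ_d), π̃_d = N(A^{-1}b,A^{-1})) whose proposal takes L steps of y^{(l)} = (I−(h/2)A)y^{(l−1)} + (h/2)b + ν^{(l)}, ν^{(l)} i.i.d. N(0,hI), starting from y^{(0)} = x, with proposal y = y^{(L)}. Suppose there are c, C > 0 and κ ≥ 0 such that the eigenvalues λ_i² of A satisfy c·i^κ ≤ λ_i ≤ C·i^κ, that φ_d satisfies the lower-bound/Lipschitz/growth assumption, and r = max{s,s',s''} satisfies ∑_{i=1}^d λ_i^{4r−2} convergent as d → ∞. If h = l² d^{-1/3−2κ} for some l > 0 and τ = lim_{d→∞} d^{-(1+6κ)} ∑_{i=1}^d λ_i⁶, then in equilibrium E[α(x,y)] → 2Φ(−l³√(Lτ)/8) and E[(x_i'−x_i)²] = 2Lh·Φ(−l³√(Lτ)/8) + o(h) as d → ∞. -/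
noncomputable section

open MeasureTheory Matrix Filter Topology

namespace AR1

/-- Density of the Gaussian distribution on `ℝ^d` with mean `m` and *precision* matrix `P`
(covariance `P⁻¹`). -/
def gaussDensity {d : ℕ} (m : Fin d → ℝ) (P : Matrix (Fin d) (Fin d) ℝ)
    (x : Fin d → ℝ) : ℝ :=
  Real.sqrt (P.det / (2 * Real.pi) ^ d) *
    Real.exp (-(1 / 2) * ((x - m) ⬝ᵥ (P *ᵥ (x - m))))

/-- Gaussian measure on `ℝ^d` with mean `m` and precision matrix `P`. -/
def gaussMeasure {d : ℕ} (m : Fin d → ℝ) (P : Matrix (Fin d) (Fin d) ℝ) :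
    Measure (Fin d → ℝ) :=
  volume.withDensity fun x => ENNReal.ofReal (gaussDensity m P x)

/-- Transition density of the stochastic AR(1) proposal `y = G x + g + ν`, `ν ~ N(0, S)`. -/
def propDensity {d : ℕ} (G : Matrix (Fin d) (Fin d) ℝ) (g : Fin d → ℝ)
    (S : Matrix (Fin d) (Fin d) ℝ) (x y : Fin d → ℝ) : ℝ :=
  gaussDensity (G *ᵥ x + g) S⁻¹ y

/-- Metropolis–Hastings acceptance probability for target density `tden` and proposal
transition density `qden`. -/
def accept {d : ℕ} (tden : (Fin d → ℝ) → ℝ) (qden : (Fin d → ℝ) → (Fin d → ℝ) → ℝ)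
    (x y : Fin d → ℝ) : ℝ :=
  min 1 (tden y * qden y x / (tden x * qden x y))

/-- Joint law of (current state, proposal) when the chain is in equilibrium. -/
def jointMeasure {d : ℕ} (tden : (Fin d → ℝ) → ℝ)
    (qden : (Fin d → ℝ) → (Fin d → ℝ) → ℝ) :
    Measure ((Fin d → ℝ) × (Fin d → ℝ)) :=
  volume.withDensity fun pr => ENNReal.ofReal (tden pr.1 * qden pr.1 pr.2)

/-- Expected Metropolis–Hastings acceptance probability in equilibrium. -/
def expAccept {d : ℕ} (tden : (Fin d → ℝ) → ℝ)
    (qden : (Fin d → ℝ) → (Fin d → ℝ) → ℝ) : ℝ :=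
  ∫ pr, accept tden qden pr.1 pr.2 ∂(jointMeasure tden qden)

/-- Expected squared jump size in direction `v`, in equilibrium:
`E[(vᵀ(x' - x))²]` where `x'` is the next state of the Metropolis–Hastings chain. -/
def expSqJump {d : ℕ} (tden : (Fin d → ℝ) → ℝ)
    (qden : (Fin d → ℝ) → (Fin d → ℝ) → ℝ) (v : Fin d → ℝ) : ℝ :=
  ∫ pr, (v ⬝ᵥ (pr.2 - pr.1)) ^ 2 * accept tden qden pr.1 pr.2 ∂(jointMeasure tden qden)

/-- `Z = log (π(y) q(y,x) / (π(x) q(x,y)))`. -/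
def logRatio {d : ℕ} (tden : (Fin d → ℝ) → ℝ)
    (qden : (Fin d → ℝ) → (Fin d → ℝ) → ℝ)
    (pr : (Fin d → ℝ) × (Fin d → ℝ)) : ℝ :=
  Real.log (tden pr.2 * qden pr.2 pr.1 / (tden pr.1 * qden pr.1 pr.2))

/-- Standard normal cumulative distribution function `Φ`. -/
def stdNormalCDF (z : ℝ) : ℝ :=
  (ProbabilityTheory.gaussianReal 0 1 (Set.Iic z)).toReal

/-- `Φ(μ/σ) + e^{μ + σ²/2} Φ(-σ - μ/σ)`. -/
def acceptLimit (μ σ : ℝ) : ℝ :=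
  stdNormalCDF (μ / σ) + Real.exp (μ + σ ^ 2 / 2) * stdNormalCDF (-σ - μ / σ)

/-- Normalized density of the target `π_d` with `dπ_d/dπ̃_d = exp(-φ)`,
`π̃_d = N(m, A⁻¹)` (precision `A`). -/
def ngDensity {d : ℕ} (φ : (Fin d → ℝ) → ℝ) (m : Fin d → ℝ)
    (A : Matrix (Fin d) (Fin d) ℝ) (x : Fin d → ℝ) : ℝ :=
  Real.exp (-(φ x)) * gaussDensity m A x /
    ∫ y, Real.exp (-(φ y)) * gaussDensity m A y

/-- Real power `A^s` of a symmetric positive definite matrix `A = Q diag(lam2) Qᵀ`. -/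
def apow {d : ℕ} (Q : Matrix (Fin d) (Fin d) ℝ) (lam2 : Fin d → ℝ) (s : ℝ) :
    Matrix (Fin d) (Fin d) ℝ :=
  Q * Matrix.diagonal (fun i => lam2 i ^ s) * Qᵀ

/-- The norm `|x|_s = |A^s x|` associated with `A = Q diag(lam2) Qᵀ`. -/
def anorm {d : ℕ} (Q : Matrix (Fin d) (Fin d) ℝ) (lam2 : Fin d → ℝ) (s : ℝ)
    (v : Fin d → ℝ) : ℝ :=
  Real.sqrt ((apow Q lam2 s *ᵥ v) ⬝ᵥ (apow Q lam2 s *ᵥ v))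

end AR1

namespace AR1

open ProbabilityTheory

/-- The symmetric matrix with orthonormal eigenvectors the columns of `Q` and eigenvalues `v`. -/
def spectralMatrix {d : ℕ} (Q : Matrix (Fin d) (Fin d) ℝ) (v : Fin d → ℝ) :
    Matrix (Fin d) (Fin d) ℝ :=
  Q * Matrix.diagonal v * Qᵀ

/-- The point whose displacement from `m` has coordinates `v` in the basis of columns of `Q`. -/
def pointOf {d : ℕ} (Q : Matrix (Fin d) (Fin d) ℝ) (m v : Fin d → ℝ) : Fin d → ℝ :=
  m + Q *ᵥ v

/-- The standard Gaussian measure on `ℝ^d`. -/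
abbrev stdGauss (d : ℕ) : Measure (Fin d → ℝ) :=
  Measure.pi fun _ => gaussianReal 0 1

section Matrices

variable {d : ℕ} {Q : Matrix (Fin d) (Fin d) ℝ}

lemma spectralMatrix_mul (hQ : Qᵀ * Q = 1) (v w : Fin d → ℝ) :
    spectralMatrix Q v * spectralMatrix Q w = spectralMatrix Q (v * w) := by
  unfold spectralMatrix
  calc Q * diagonal v * Qᵀ * (Q * diagonal w * Qᵀ)
      = Q * diagonal v * (Qᵀ * Q) * diagonal w * Qᵀ := by simp only [Matrix.mul_assoc]
    _ = Q * diagonal (v * w) * Qᵀ := by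
        rw [hQ, Matrix.mul_one, Matrix.mul_assoc Q, Matrix.diagonal_mul_diagonal]; rfl

lemma spectralMatrix_one (hQ : Qᵀ * Q = 1) : spectralMatrix Q 1 = 1 := by
  have : diagonal (1 : Fin d → ℝ) = 1 := Matrix.diagonal_one
  rw [spectralMatrix, this, Matrix.mul_one, mul_eq_one_comm.mp hQ]

lemma spectralMatrix_pow (hQ : Qᵀ * Q = 1) (v : Fin d → ℝ) (n : ℕ) :
    spectralMatrix Q v ^ n = spectralMatrix Q (v ^ n) := by
  induction n with
  | zero => simp [spectralMatrix_one hQ]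
  | succ n ih => rw [pow_succ, ih, spectralMatrix_mul hQ, pow_succ]

lemma spectralMatrix_smul (a : ℝ) (v : Fin d → ℝ) :
    a • spectralMatrix Q v = spectralMatrix Q (a • v) := by
  simp [spectralMatrix, Matrix.diagonal_smul]

lemma spectralMatrix_sub (v w : Fin d → ℝ) :
    spectralMatrix Q v - spectralMatrix Q w = spectralMatrix Q (v - w) := by
  unfold spectralMatrix
  rw [← Matrix.sub_mul, ← Matrix.mul_sub, Matrix.diagonal_sub]; rfl

lemma spectralMatrix_sum {ι : Type*} (t : Finset ι) (v : ι → Fin d → ℝ) :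
    ∑ j ∈ t, spectralMatrix Q (v j) = spectralMatrix Q (∑ j ∈ t, v j) := by
  classical
  induction t using Finset.induction_on with
  | empty => simp [spectralMatrix]
  | insert a t ha ih =>
    rw [Finset.sum_insert ha, Finset.sum_insert ha, ih]
    unfold spectralMatrix
    rw [← Matrix.add_mul, ← Matrix.mul_add, Matrix.diagonal_add]; rfl

lemma spectralMatrix_transpose (v : Fin d → ℝ) :
    (spectralMatrix Q v)ᵀ = spectralMatrix Q v := by
  simp [spectralMatrix, Matrix.mul_assoc]

lemma spectralMatrix_inv (hQ : Qᵀ * Q = 1) {v : Fin d → ℝ} (hv : ∀ i, v i ≠ 0) :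
    (spectralMatrix Q v)⁻¹ = spectralMatrix Q v⁻¹ := by
  refine Matrix.inv_eq_right_inv ?_
  rw [spectralMatrix_mul hQ, ← spectralMatrix_one hQ]
  congr 1
  ext i
  simp [hv i]

lemma spectralMatrix_mulVec (hQ : Qᵀ * Q = 1) (v w : Fin d → ℝ) :
    spectralMatrix Q v *ᵥ (Q *ᵥ w) = Q *ᵥ (v * w) := by
  rw [spectralMatrix, Matrix.mulVec_mulVec, Matrix.mul_assoc, hQ, Matrix.mul_one,
    ← Matrix.mulVec_mulVec]
  congr 1
  ext i
  simp [Matrix.mulVec_diagonal]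

lemma dotProduct_mulVec_orthogonal (hQ : Qᵀ * Q = 1) (v w : Fin d → ℝ) :
    (Q *ᵥ v) ⬝ᵥ (Q *ᵥ w) = v ⬝ᵥ w := by
  rw [Matrix.dotProduct_mulVec, Matrix.vecMul_mulVec, hQ, Matrix.vecMul_one]

lemma det_spectralMatrix (hQ : Qᵀ * Q = 1) (v : Fin d → ℝ) :
    (spectralMatrix Q v).det = ∏ i, v i := by
  have h : Q.det * Q.det = 1 := by
    have := congrArg Matrix.det hQ
    simpa using this
  rw [spectralMatrix, Matrix.det_mul, Matrix.det_mul, Matrix.det_transpose, Matrix.det_diagonal]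
  linear_combination (∏ i, v i) * h

lemma quadForm_spectralMatrix (hQ : Qᵀ * Q = 1) (v w : Fin d → ℝ) :
    (Q *ᵥ w) ⬝ᵥ (spectralMatrix Q v *ᵥ (Q *ᵥ w)) = ∑ i, v i * w i ^ 2 := by
  rw [spectralMatrix_mulVec hQ, dotProduct_mulVec_orthogonal hQ, dotProduct]
  exact Finset.sum_congr rfl fun i _ => by simp; ring

lemma gaussDensity_pos (m : Fin d → ℝ) (hQ : Qᵀ * Q = 1) {v : Fin d → ℝ} (hv : ∀ i, 0 < v i)
    (x : Fin d → ℝ) : 0 < gaussDensity m (spectralMatrix Q v) x := by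
  unfold gaussDensity
  rw [det_spectralMatrix hQ]
  have := Finset.prod_pos fun i (_ : i ∈ Finset.univ) => hv i
  positivity

end Matrices

section ChangeOfVariables

variable {d : ℕ} {Q : Matrix (Fin d) (Fin d) ℝ}

lemma stdGauss_eq_withDensity (d : ℕ) :
    stdGauss d = volume.withDensity
      fun x : Fin d → ℝ => ENNReal.ofReal (∏ i, gaussianPDFReal 0 1 (x i)) := by
  refine (Measure.pi_eq fun s hs => ?_)
  rw [withDensity_apply _ (MeasurableSet.univ_pi hs), ← lintegral_indicator
    (MeasurableSet.univ_pi hs)]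
  have h1 : ∀ x : Fin d → ℝ, (Set.univ.pi s).indicator
      (fun x : Fin d → ℝ => ENNReal.ofReal (∏ i, gaussianPDFReal 0 1 (x i))) x =
      ENNReal.ofReal (∏ i, (s i).indicator (gaussianPDFReal 0 1) (x i)) := by
    intro x
    by_cases hx : x ∈ Set.univ.pi s
    · rw [Set.indicator_of_mem hx]
      congr 1
      refine Finset.prod_congr rfl fun i _ => ?_
      rw [Set.indicator_of_mem (hx i (Set.mem_univ i))]
    · rw [Set.indicator_of_notMem hx]
      simp only [Set.mem_univ_pi, not_forall] at hx
      obtain ⟨i, hi⟩ := hx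
      rw [Finset.prod_eq_zero (Finset.mem_univ i) (Set.indicator_of_notMem hi _),
        ENNReal.ofReal_zero]
  simp_rw [h1]
  have hInt : ∀ i, Integrable ((s i).indicator (gaussianPDFReal 0 1)) :=
    fun i => (integrable_gaussianPDFReal 0 1).indicator (hs i)
  have hnn : ∀ i t, 0 ≤ (s i).indicator (gaussianPDFReal 0 1) t :=
    fun i t => Set.indicator_nonneg (fun _ _ => gaussianPDFReal_nonneg _ _ _) t
  rw [← ofReal_integral_eq_lintegral_ofReal
    (by rw [volume_pi]; exact Integrable.fintype_prod hInt)
    (Eventually.of_forall fun x => Finset.prod_nonneg fun i _ => hnn i (x i)),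
    integral_fintype_prod_volume_eq_prod,
    ENNReal.ofReal_prod_of_nonneg (fun i _ => integral_nonneg (hnn i))]
  refine Finset.prod_congr rfl fun i _ => ?_
  rw [integral_indicator (hs i), gaussianReal_apply_eq_integral 0 one_ne_zero]

lemma measurable_pointOf (Q : Matrix (Fin d) (Fin d) ℝ) (m : Fin d → ℝ) :
    Measurable (pointOf Q m) := by
  unfold pointOf
  exact (Continuous.matrix_mulVec continuous_const continuous_id).measurable.const_add m

lemma gaussDensity_pointOf (hQ : Qᵀ * Q = 1) (m : Fin d → ℝ) {w : Fin d → ℝ}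
    (hw : ∀ i, 0 < w i) (ξ : Fin d → ℝ) :
    gaussDensity m (spectralMatrix Q fun i => (w i ^ 2)⁻¹) (pointOf Q m (w * ξ)) =
      (∏ i, w i)⁻¹ * ∏ i, gaussianPDFReal 0 1 (ξ i) := by
  unfold gaussDensity pointOf
  rw [add_sub_cancel_left, quadForm_spectralMatrix hQ, det_spectralMatrix hQ]
  simp only [gaussianPDFReal, Finset.prod_mul_distrib, ← Real.exp_sum]
  have h1 : ∀ i, (w i ^ 2)⁻¹ * (w * ξ) i ^ 2 = ξ i ^ 2 := by
    intro i
    have := (hw i).ne'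
    simp only [Pi.mul_apply]
    field_simp
  simp_rw [h1]
  have h2 : Real.sqrt ((∏ i, (w i ^ 2)⁻¹) / (2 * Real.pi) ^ d) =
      (∏ i, w i)⁻¹ * ∏ _i : Fin d, (Real.sqrt (2 * Real.pi * (1 : NNReal)))⁻¹ := by
    have hp := Finset.prod_pos fun i (_ : i ∈ Finset.univ) => hw i
    rw [Real.sqrt_eq_iff_mul_self_eq (by positivity) (by positivity)]
    simp only [Finset.prod_const, Finset.card_univ, Fintype.card_fin, NNReal.coe_one, mul_one,
      Finset.prod_inv_distrib, Finset.prod_pow]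
    have h3 : (Real.sqrt (2 * Real.pi) ^ d) ^ 2 = (2 * Real.pi) ^ d := by
      rw [← pow_mul, mul_comm d 2, pow_mul, Real.sq_sqrt (by positivity)]
    rw [← h3, inv_pow]
    have : (0 : ℝ) < Real.sqrt (2 * Real.pi) ^ d := by positivity
    generalize Real.sqrt (2 * Real.pi) ^ d = t at this
    field_simp
  rw [h2, mul_assoc]
  congr 3
  rw [Finset.mul_sum]
  exact Finset.sum_congr rfl fun i _ => by simp; ring

lemma lintegral_gaussDensity (hQ : Qᵀ * Q = 1) (m : Fin d → ℝ) {w : Fin d → ℝ}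
    (hw : ∀ i, 0 < w i) {F : (Fin d → ℝ) → ENNReal} (hF : Measurable F) :
    ∫⁻ y, F y * ENNReal.ofReal (gaussDensity m (spectralMatrix Q fun i => (w i ^ 2)⁻¹) y) =
      ∫⁻ ξ, F (pointOf Q m (w * ξ)) ∂(stdGauss d) := by
  have hp := Finset.prod_pos fun i (_ : i ∈ Finset.univ) => hw i
  have hdetQ : |Q.det| = 1 := by
    have h : Q.det * Q.det = 1 := by simpa using congrArg Matrix.det hQ
    rcases mul_self_eq_one_iff.mp h with h | h <;> simp [h]
  set M : Matrix (Fin d) (Fin d) ℝ := Q * diagonal w with hM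
  have hdet : |M.det| = ∏ i, w i := by
    rw [hM, Matrix.det_mul, abs_mul, hdetQ, one_mul, Matrix.det_diagonal, abs_of_pos hp]
  have hdet0 : M.det ≠ 0 := by
    intro h
    rw [h, abs_zero] at hdet
    exact hp.ne hdet
  have hMv : ∀ ξ : Fin d → ℝ, m + Matrix.toLin' M ξ = pointOf Q m (w * ξ) := by
    intro ξ
    rw [pointOf, Matrix.toLin'_apply, hM, ← Matrix.mulVec_mulVec]
    congr 2
    ext i
    simp [Matrix.mulVec_diagonal]
  have hgm : Measurable fun y =>
      ENNReal.ofReal (gaussDensity m (spectralMatrix Q fun i => (w i ^ 2)⁻¹) y) := by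
    unfold gaussDensity
    refine ENNReal.measurable_ofReal.comp (Continuous.measurable ?_)
    unfold dotProduct mulVec dotProduct
    fun_prop
  set H : (Fin d → ℝ) → ENNReal := fun y =>
    F y * ENNReal.ofReal (gaussDensity m (spectralMatrix Q fun i => (w i ^ 2)⁻¹) y) with hH
  have hHm : Measurable H := hF.mul hgm
  have key := Real.map_matrix_volume_pi_eq_smul_volume_pi hdet0
  have hLm : Measurable (Matrix.toLin' M) :=
    (LinearMap.continuous_of_finiteDimensional _).measurable
  have e1 : ∫⁻ ξ, H (m + Matrix.toLin' M ξ) = ENNReal.ofReal |M.det⁻¹| * ∫⁻ y, H y := by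
    rw [← lintegral_add_left_eq_self H m, ← smul_eq_mul, ← lintegral_smul_measure, ← key,
      lintegral_map (by fun_prop) hLm]
  have hc : ENNReal.ofReal (∏ i, w i) * ENNReal.ofReal |M.det⁻¹| = 1 := by
    rw [← ENNReal.ofReal_mul hp.le, abs_inv, hdet, mul_inv_cancel₀ hp.ne', ENNReal.ofReal_one]
  have e2 : ∫⁻ y, H y = ENNReal.ofReal (∏ i, w i) * ∫⁻ ξ, H (m + Matrix.toLin' M ξ) := by
    rw [e1, ← mul_assoc, hc, one_mul]
  have hG : Measurable fun ξ : Fin d → ℝ => F (pointOf Q m (w * ξ)) :=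
    hF.comp ((measurable_pointOf Q m).comp (by fun_prop))
  have hK : Measurable fun ξ : Fin d → ℝ => H (m + Matrix.toLin' M ξ) :=
    hHm.comp (hLm.const_add m)
  rw [e2, stdGauss_eq_withDensity, lintegral_withDensity_eq_lintegral_mul _
    (by
      refine ENNReal.measurable_ofReal.comp (Finset.measurable_prod _ fun i _ => ?_)
      exact (measurable_gaussianPDFReal 0 1).comp (measurable_pi_apply i))
    hG, ← lintegral_const_mul _ hK]
  refine lintegral_congr fun ξ => ?_
  simp only [hH, hMv, gaussDensity_pointOf hQ m hw, Pi.mul_apply]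
  rw [mul_comm (ENNReal.ofReal (∏ i, gaussianPDFReal 0 1 (ξ i))), mul_left_comm,
    ← ENNReal.ofReal_mul hp.le, mul_inv_cancel_left₀ hp.ne']

end ChangeOfVariables

section Joint

variable {d : ℕ} {Q : Matrix (Fin d) (Fin d) ℝ}

lemma pointOf_pointOf (Q : Matrix (Fin d) (Fin d) ℝ) (m v w : Fin d → ℝ) :
    pointOf Q (pointOf Q m v) w = pointOf Q m (v + w) := by
  simp [pointOf, Matrix.mulVec_add, add_assoc]

lemma measurable_propDensity (G : Matrix (Fin d) (Fin d) ℝ) (g : Fin d → ℝ)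
    (S : Matrix (Fin d) (Fin d) ℝ) :
    Measurable fun p : (Fin d → ℝ) × (Fin d → ℝ) => propDensity G g S p.1 p.2 := by
  unfold propDensity gaussDensity
  refine Continuous.measurable ?_
  unfold dotProduct mulVec dotProduct
  fun_prop

lemma measurable_gaussDensity (m : Fin d → ℝ) (P : Matrix (Fin d) (Fin d) ℝ) :
    Measurable (gaussDensity m P) := by
  unfold gaussDensity
  refine Continuous.measurable ?_
  unfold dotProduct mulVec dotProduct
  fun_prop

lemma measurable_ngDensity {φ : (Fin d → ℝ) → ℝ} (hφ : Measurable φ) (m : Fin d → ℝ)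
    (A : Matrix (Fin d) (Fin d) ℝ) : Measurable (ngDensity φ m A) := by
  unfold ngDensity
  have hg := measurable_gaussDensity m A
  fun_prop

/-- Current state in terms of the standard Gaussian coordinates `ξ`. -/
def statePoint (Q : Matrix (Fin d) (Fin d) ℝ) (m w ξ : Fin d → ℝ) : Fin d → ℝ :=
  pointOf Q m (w * ξ)

/-- Proposal in terms of the standard Gaussian coordinates `(ξ, ζ)`. -/
def propPoint (Q : Matrix (Fin d) (Fin d) ℝ) (m w g z : Fin d → ℝ)
    (p : (Fin d → ℝ) × (Fin d → ℝ)) : Fin d → ℝ :=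
  pointOf Q m (g * (w * p.1) + z * p.2)

/-- Density of the target with respect to its Gaussian reference, in the coordinates `ξ`. -/
def weight (φ : (Fin d → ℝ) → ℝ) (Q : Matrix (Fin d) (Fin d) ℝ) (m w ξ : Fin d → ℝ) : ℝ :=
  Real.exp (-(φ (statePoint Q m w ξ))) / ∫ η, Real.exp (-(φ (statePoint Q m w η))) ∂(stdGauss d)

lemma measurable_statePoint (Q : Matrix (Fin d) (Fin d) ℝ) (m w : Fin d → ℝ) :
    Measurable (statePoint Q m w) :=
  (measurable_pointOf Q m).comp (by fun_prop)

lemma measurable_propPoint (Q : Matrix (Fin d) (Fin d) ℝ) (m w g z : Fin d → ℝ) :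
    Measurable (propPoint Q m w g z) :=
  (measurable_pointOf Q m).comp (by fun_prop)

lemma measurable_weight {φ : (Fin d → ℝ) → ℝ} (hφ : Measurable φ)
    (Q : Matrix (Fin d) (Fin d) ℝ) (m w : Fin d → ℝ) : Measurable (weight φ Q m w) := by
  unfold weight
  exact (Real.measurable_exp.comp (hφ.comp (measurable_statePoint Q m w)).neg).div_const _

lemma weight_nonneg (φ : (Fin d → ℝ) → ℝ) (Q : Matrix (Fin d) (Fin d) ℝ)
    (m w ξ : Fin d → ℝ) : 0 ≤ weight φ Q m w ξ :=
  div_nonneg (Real.exp_pos _).le (integral_nonneg fun _ => (Real.exp_pos _).le)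

lemma integral_exp_mul_gaussDensity (hQ : Qᵀ * Q = 1) {φ : (Fin d → ℝ) → ℝ} (hφ : Measurable φ)
    (m : Fin d → ℝ) {w : Fin d → ℝ} (hw : ∀ i, 0 < w i) :
    ∫ y, Real.exp (-(φ y)) * gaussDensity m (spectralMatrix Q fun i => (w i ^ 2)⁻¹) y =
      ∫ ξ, Real.exp (-(φ (statePoint Q m w ξ))) ∂(stdGauss d) := by
  have hv : ∀ i, 0 < (w i ^ 2)⁻¹ := fun i => by have := hw i; positivity
  have hm : Measurable fun y => Real.exp (-(φ y)) := Real.measurable_exp.comp hφ.neg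
  have hg : Measurable (gaussDensity m (spectralMatrix Q fun i => (w i ^ 2)⁻¹)) :=
    measurable_gaussDensity _ _
  rw [integral_eq_lintegral_of_nonneg_ae
      (Eventually.of_forall fun y => mul_nonneg (Real.exp_pos _).le (gaussDensity_pos m hQ hv y).le)
      (hm.mul hg).aestronglyMeasurable,
    integral_eq_lintegral_of_nonneg_ae (Eventually.of_forall fun y => (Real.exp_pos _).le)
      (hm.comp (measurable_statePoint Q m w)).aestronglyMeasurable]
  have := lintegral_gaussDensity hQ m hw (ENNReal.measurable_ofReal.comp hm)
  simp only [Function.comp_apply, ← ENNReal.ofReal_mul (Real.exp_pos _).le] at this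
  rw [this]
  rfl

lemma jointMeasure_eq (hQ : Qᵀ * Q = 1) {φ : (Fin d → ℝ) → ℝ} (hφ : Measurable φ)
    (m : Fin d → ℝ) {w g z : Fin d → ℝ} (hw : ∀ i, 0 < w i) (hz : ∀ i, 0 < z i)
    {S : Matrix (Fin d) (Fin d) ℝ} (hS : S⁻¹ = spectralMatrix Q fun i => (z i ^ 2)⁻¹)
    {gv : Fin d → ℝ} (hgv : gv = m - spectralMatrix Q g *ᵥ m) :
    jointMeasure (ngDensity φ m (spectralMatrix Q fun i => (w i ^ 2)⁻¹))
        (propDensity (spectralMatrix Q g) gv S) =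
      (((stdGauss d).prod (stdGauss d)).withDensity
        fun p => ENNReal.ofReal (weight φ Q m w p.1)).map
        fun p => (statePoint Q m w p.1, propPoint Q m w g z p) := by
  have hv : ∀ i, 0 < (w i ^ 2)⁻¹ := fun i => by have := hw i; positivity
  have hv' : ∀ i, 0 < (z i ^ 2)⁻¹ := fun i => by have := hz i; positivity
  set A := spectralMatrix Q fun i => (w i ^ 2)⁻¹ with hA
  set Zc := ∫ y, Real.exp (-(φ y)) * gaussDensity m A y with hZ
  have hZ0 : 0 ≤ Zc := integral_nonneg fun y =>
    mul_nonneg (Real.exp_pos _).le (gaussDensity_pos m hQ hv y).le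
  have hexp : Measurable fun x => Real.exp (-(φ x)) := Real.measurable_exp.comp hφ.neg
  have hmul : Measurable fun x : Fin d → ℝ => spectralMatrix Q g *ᵥ x + gv :=
    (Continuous.matrix_mulVec continuous_const continuous_id).measurable.add_const gv
  have ht : Measurable (ngDensity φ m A) := measurable_ngDensity hφ m A
  have hq : Measurable fun p : (Fin d → ℝ) × (Fin d → ℝ) =>
      propDensity (spectralMatrix Q g) gv S p.1 p.2 :=
    measurable_propDensity _ _ _
  have hΨ : Measurable fun p : (Fin d → ℝ) × (Fin d → ℝ) =>
      (statePoint Q m w p.1, propPoint Q m w g z p) :=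
    ((measurable_statePoint Q m w).comp measurable_fst).prodMk (measurable_propPoint Q m w g z)
  have hwt : Measurable fun p : (Fin d → ℝ) × (Fin d → ℝ) =>
      ENNReal.ofReal (weight φ Q m w p.1) :=
    ENNReal.measurable_ofReal.comp ((measurable_weight hφ Q m w).comp measurable_fst)
  have htq : Measurable fun p : (Fin d → ℝ) × (Fin d → ℝ) => ENNReal.ofReal
      (ngDensity φ m A p.1 * propDensity (spectralMatrix Q g) gv S p.1 p.2) :=
    ENNReal.measurable_ofReal.comp ((ht.comp measurable_fst).mul hq)
  refine Measure.ext_of_lintegral _ fun F hF => ?_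
  have hFΨ : Measurable fun p : (Fin d → ℝ) × (Fin d → ℝ) =>
      F (statePoint Q m w p.1, propPoint Q m w g z p) := hF.comp hΨ
  rw [lintegral_map hF hΨ, lintegral_withDensity_eq_lintegral_mul _ hwt hFΨ, jointMeasure,
    lintegral_withDensity_eq_lintegral_mul _ htq hF, Measure.volume_eq_prod,
    lintegral_prod _ (htq.mul hF).aemeasurable, lintegral_prod _ (hwt.mul hFΨ).aemeasurable]
  have htn : ∀ x, 0 ≤ ngDensity φ m A x := fun x => div_nonneg
    (mul_nonneg (Real.exp_pos _).le (gaussDensity_pos m hQ hv x).le) hZ0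
  set J : (Fin d → ℝ) → ENNReal := fun x =>
    ∫⁻ ζ, F (x, pointOf Q (spectralMatrix Q g *ᵥ x + gv) (z * ζ)) ∂(stdGauss d) with hJ
  have hJm : Measurable J := by
    refine Measurable.lintegral_prod_right' (f := fun p : (Fin d → ℝ) × (Fin d → ℝ) =>
      F (p.1, pointOf Q (spectralMatrix Q g *ᵥ p.1 + gv) (z * p.2))) ?_
    refine hF.comp (measurable_fst.prodMk ?_)
    unfold pointOf
    exact (hmul.comp measurable_fst).add
      ((Continuous.matrix_mulVec continuous_const continuous_id).measurable.comp (by fun_prop))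
  have inner : ∀ x, ∫⁻ y, ((fun p : (Fin d → ℝ) × (Fin d → ℝ) => ENNReal.ofReal
      (ngDensity φ m A p.1 * propDensity (spectralMatrix Q g) gv S p.1 p.2)) * F) (x, y) =
      ENNReal.ofReal (Real.exp (-(φ x)) / Zc) * J x * ENNReal.ofReal (gaussDensity m A x) := by
    intro x
    have hFx : Measurable fun y => F (x, y) := hF.comp (measurable_const.prodMk measurable_id)
    have h := lintegral_gaussDensity hQ (spectralMatrix Q g *ᵥ x + gv) hz hFx
    rw [← hS] at h
    simp only [hJ, ← h]
    rw [mul_right_comm, ← ENNReal.ofReal_mul (by positivity), ← lintegral_const_mul']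
    · refine lintegral_congr fun y => ?_
      simp only [Pi.mul_apply, ENNReal.ofReal_mul (htn x)]
      rw [show ngDensity φ m A x = Real.exp (-(φ x)) / Zc * gaussDensity m A x by
        rw [ngDensity, ← hZ]; ring, propDensity, mul_assoc, mul_comm (F (x, y))]
    · exact ENNReal.ofReal_ne_top
  simp_rw [inner]
  have hK : Measurable fun x => ENNReal.ofReal (Real.exp (-(φ x)) / Zc) * J x :=
    (ENNReal.measurable_ofReal.comp (hexp.div_const _)).mul hJm
  rw [hA, lintegral_gaussDensity hQ m hw hK]
  refine lintegral_congr fun ξ => ?_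
  simp only [Pi.mul_apply]
  rw [lintegral_const_mul' _ _ ENNReal.ofReal_ne_top, weight, hZ, hA,
    integral_exp_mul_gaussDensity hQ hφ m hw]
  congr 1
  simp only [hJ]
  refine lintegral_congr fun ζ => ?_
  congr 2
  rw [propPoint, ← pointOf_pointOf, hgv]
  congr 1
  rw [pointOf, Matrix.mulVec_add, spectralMatrix_mulVec hQ]
  simp only [pointOf]
  abel

lemma integral_jointMeasure (hQ : Qᵀ * Q = 1) {φ : (Fin d → ℝ) → ℝ} (hφ : Measurable φ)
    (m : Fin d → ℝ) {w g z : Fin d → ℝ} (hw : ∀ i, 0 < w i) (hz : ∀ i, 0 < z i)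
    {S : Matrix (Fin d) (Fin d) ℝ} (hS : S⁻¹ = spectralMatrix Q fun i => (z i ^ 2)⁻¹)
    {gv : Fin d → ℝ} (hgv : gv = m - spectralMatrix Q g *ᵥ m)
    {F : (Fin d → ℝ) × (Fin d → ℝ) → ℝ} (hF : Measurable F) :
    ∫ p, F p ∂(jointMeasure (ngDensity φ m (spectralMatrix Q fun i => (w i ^ 2)⁻¹))
        (propDensity (spectralMatrix Q g) gv S)) =
      ∫ p, weight φ Q m w p.1 * F (statePoint Q m w p.1, propPoint Q m w g z p)
        ∂((stdGauss d).prod (stdGauss d)) := by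
  have hΨ : Measurable fun p : (Fin d → ℝ) × (Fin d → ℝ) =>
      (statePoint Q m w p.1, propPoint Q m w g z p) :=
    ((measurable_statePoint Q m w).comp measurable_fst).prodMk (measurable_propPoint Q m w g z)
  have hwt : Measurable fun p : (Fin d → ℝ) × (Fin d → ℝ) =>
      ENNReal.ofReal (weight φ Q m w p.1) :=
    ENNReal.measurable_ofReal.comp ((measurable_weight hφ Q m w).comp measurable_fst)
  rw [jointMeasure_eq hQ hφ m hw hz hS hgv, integral_map hΨ.aemeasurable hF.aestronglyMeasurable,
    integral_withDensity_eq_integral_toReal_smul hwt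
      (Eventually.of_forall fun _ => ENNReal.ofReal_lt_top)]
  refine integral_congr_ae (Eventually.of_forall fun p => ?_)
  simp only [smul_eq_mul]
  rw [ENNReal.toReal_ofReal (weight_nonneg _ _ _ _ _)]

/-- The logarithm of the Metropolis–Hastings ratio in Gaussian coordinates. -/
def logRatioCoord (φ : (Fin d → ℝ) → ℝ) (Q : Matrix (Fin d) (Fin d) ℝ) (m w g z : Fin d → ℝ)
    (p : (Fin d → ℝ) × (Fin d → ℝ)) : ℝ :=
  φ (statePoint Q m w p.1) - φ (propPoint Q m w g z p) +
    ∑ i, 1 / 2 * ((w i ^ 2)⁻¹ - (1 - g i ^ 2) / z i ^ 2) *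
      ((w i * p.1 i) ^ 2 - (g i * (w i * p.1 i) + z i * p.2 i) ^ 2)

lemma accept_coord (hQ : Qᵀ * Q = 1) {φ : (Fin d → ℝ) → ℝ}
    (m : Fin d → ℝ) {w g z : Fin d → ℝ} (hw : ∀ i, 0 < w i) (hz : ∀ i, 0 < z i)
    {S : Matrix (Fin d) (Fin d) ℝ} (hS : S⁻¹ = spectralMatrix Q fun i => (z i ^ 2)⁻¹)
    {gv : Fin d → ℝ} (hgv : gv = m - spectralMatrix Q g *ᵥ m)
    (hZ : 0 < ∫ y, Real.exp (-(φ y)) * gaussDensity m (spectralMatrix Q fun i => (w i ^ 2)⁻¹) y)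
    (p : (Fin d → ℝ) × (Fin d → ℝ)) :
    accept (ngDensity φ m (spectralMatrix Q fun i => (w i ^ 2)⁻¹))
        (propDensity (spectralMatrix Q g) gv S) (statePoint Q m w p.1) (propPoint Q m w g z p) =
      min 1 (Real.exp (logRatioCoord φ Q m w g z p)) := by
  have hv : ∀ i, 0 < (w i ^ 2)⁻¹ := fun i => by have := hw i; positivity
  have hv' : ∀ i, 0 < (z i ^ 2)⁻¹ := fun i => by have := hz i; positivity
  unfold accept
  congr 1
  have hmean : ∀ u, spectralMatrix Q g *ᵥ pointOf Q m u + gv = pointOf Q m (g * u) := by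
    intro u
    rw [hgv, pointOf, Matrix.mulVec_add, spectralMatrix_mulVec hQ, pointOf]
    abel
  have hgauss : ∀ (v u u' : Fin d → ℝ), gaussDensity (pointOf Q m u) (spectralMatrix Q v)
      (pointOf Q m u') = Real.sqrt ((∏ i, v i) / (2 * Real.pi) ^ d) *
        Real.exp (-(1 / 2) * ∑ i, v i * (u' i - u i) ^ 2) := by
    intro v u u'
    have : pointOf Q m u' - pointOf Q m u = Q *ᵥ (u' - u) := by
      simp [pointOf, Matrix.mulVec_sub]
    rw [gaussDensity, this, quadForm_spectralMatrix hQ, det_spectralMatrix hQ]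
    rfl
  have hm0 : m = pointOf Q m 0 := by simp [pointOf]
  have hgaussm : ∀ (v u' : Fin d → ℝ), gaussDensity m (spectralMatrix Q v)
      (pointOf Q m u') = Real.sqrt ((∏ i, v i) / (2 * Real.pi) ^ d) *
        Real.exp (-(1 / 2) * ∑ i, v i * (u' i) ^ 2) := by
    intro v u'
    have := hgauss v 0 u'
    rw [← hm0] at this
    simpa using this
  set Zc := ∫ y, Real.exp (-(φ y)) * gaussDensity m (spectralMatrix Q fun i => (w i ^ 2)⁻¹) y
    with hZc
  simp only [ngDensity, propDensity, hS, ← hZc]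
  unfold logRatioCoord statePoint propPoint
  set u := w * p.1 with hu
  set v := g * u + z * p.2 with hvv
  rw [hmean, hmean, hgaussm, hgaussm, hgauss, hgauss]
  have hp1 : 0 < Real.sqrt ((∏ i, (w i ^ 2)⁻¹) / (2 * Real.pi) ^ d) := by
    have := Finset.prod_pos fun i (_ : i ∈ Finset.univ) => hv i
    positivity
  have hp2 : 0 < Real.sqrt ((∏ i, (z i ^ 2)⁻¹) / (2 * Real.pi) ^ d) := by
    have := Finset.prod_pos fun i (_ : i ∈ Finset.univ) => hv' i
    positivity
  generalize Real.sqrt ((∏ i, (w i ^ 2)⁻¹) / (2 * Real.pi) ^ d) = k1 at hp1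
  generalize Real.sqrt ((∏ i, (z i ^ 2)⁻¹) / (2 * Real.pi) ^ d) = k2 at hp2
  have halg : ∀ a b c e a' b' : ℝ,
      Real.exp (-a') * (k1 * Real.exp b') / Zc * (k2 * Real.exp c) /
        (Real.exp (-a) * (k1 * Real.exp b) / Zc * (k2 * Real.exp e)) =
      Real.exp (a - a' + (b' + c - b - e)) := by
    intro a b c e a' b'
    rw [show a - a' + (b' + c - b - e) = (-a' + b' + c) - (-a + b + e) by ring, Real.exp_sub,
      Real.exp_add, Real.exp_add, Real.exp_add, Real.exp_add]
    have := hZ.ne'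
    field_simp
  rw [halg]
  congr 2
  simp only [Finset.mul_sum, ← Finset.sum_add_distrib, ← Finset.sum_sub_distrib]
  refine Finset.sum_congr rfl fun i _ => ?_
  have h1 : w i * p.1 i = u i := rfl
  have h2 : g i * u i + z i * p.2 i = v i := rfl
  rw [h1, h2]
  have := (hz i).ne'
  simp only [Pi.mul_apply]
  field_simp
  ring

lemma col_dotProduct_sub (hQ : Qᵀ * Q = 1) (m w g z : Fin d → ℝ)
    (p : (Fin d → ℝ) × (Fin d → ℝ)) (i : Fin d) :
    (fun k => Q k i) ⬝ᵥ (propPoint Q m w g z p - statePoint Q m w p.1) =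
      z i * p.2 i - (1 - g i) * (w i * p.1 i) := by
  have h1 : propPoint Q m w g z p - statePoint Q m w p.1 =
      Q *ᵥ (g * (w * p.1) + z * p.2 - w * p.1) := by
    simp only [propPoint, statePoint, pointOf, Matrix.mulVec_sub]; abel
  have h2 : ∀ x, (fun k => Q k i) ⬝ᵥ (Q *ᵥ x) = x i := by
    intro x
    have : (Qᵀ *ᵥ (Q *ᵥ x)) i = x i := by rw [Matrix.mulVec_mulVec, hQ, Matrix.one_mulVec]
    exact this
  rw [h1, h2]
  simp
  ring

lemma measurable_logRatioCoord {φ : (Fin d → ℝ) → ℝ} (hφ : Measurable φ)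
    (Q : Matrix (Fin d) (Fin d) ℝ) (m w g z : Fin d → ℝ) :
    Measurable (logRatioCoord φ Q m w g z) := by
  unfold logRatioCoord
  refine ((hφ.comp ((measurable_statePoint Q m w).comp measurable_fst)).sub
    (hφ.comp (measurable_propPoint Q m w g z))).add ?_
  fun_prop

lemma measurable_accept {tden : (Fin d → ℝ) → ℝ} {qden : (Fin d → ℝ) → (Fin d → ℝ) → ℝ}
    (ht : Measurable tden) (hq : Measurable fun p : (Fin d → ℝ) × (Fin d → ℝ) => qden p.1 p.2) :
    Measurable fun p : (Fin d → ℝ) × (Fin d → ℝ) => accept tden qden p.1 p.2 := by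
  have hq' : Measurable fun p : (Fin d → ℝ) × (Fin d → ℝ) => qden p.2 p.1 :=
    hq.comp measurable_swap
  exact measurable_const.min ((((ht.comp measurable_snd).mul hq')).div
    ((ht.comp measurable_fst).mul hq))

end Joint

section OneDim

lemma abs_min_one_exp_sub_le (a b : ℝ) :
    |min 1 (Real.exp a) - min 1 (Real.exp b)| ≤ min 1 |a - b| := by
  wlog h : b ≤ a generalizing a b
  · rw [abs_sub_comm, abs_sub_comm a b]
    exact this b a (le_of_not_ge h)
  have hmono : min 1 (Real.exp b) ≤ min 1 (Real.exp a) :=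
    min_le_min_left _ (Real.exp_le_exp.mpr h)
  rw [abs_of_nonneg (sub_nonneg.mpr hmono), abs_of_nonneg (sub_nonneg.mpr h)]
  have hb : 0 < min 1 (Real.exp b) := lt_min one_pos (Real.exp_pos b)
  refine le_min (by linarith [min_le_left 1 (Real.exp a)]) ?_
  have h1 := Real.add_one_le_exp (b - a)
  have h2 : Real.exp b = Real.exp a * Real.exp (b - a) := by rw [← Real.exp_add]; ring_nf
  have h3 : Real.exp (b - a) ≤ 1 := Real.exp_le_one_iff.mpr (by linarith)
  have h4 : min 1 (Real.exp a) * Real.exp (b - a) ≤ min 1 (Real.exp b) := by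
    refine le_min ?_ ?_
    · exact mul_le_one₀ (min_le_left _ _) (Real.exp_pos _).le h3
    · rw [h2]
      exact mul_le_mul_of_nonneg_right (min_le_right _ _) (Real.exp_pos _).le
  have h5 : min 1 (Real.exp a) * (1 - Real.exp (b - a)) ≤ 1 * (a - b) :=
    mul_le_mul (min_le_left _ _) (by linarith) (by linarith) zero_le_one
  linarith

lemma min_one_exp_nonneg (a : ℝ) : 0 ≤ min 1 (Real.exp a) := le_min zero_le_one (Real.exp_pos a).le

lemma measurable_min_one_exp : Measurable fun t : ℝ => min 1 (Real.exp t) := by fun_prop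

lemma integral_min_one_exp_gaussian {σ : ℝ} (hσ : 0 ≤ σ) :
    ∫ t, min 1 (Real.exp (-(σ ^ 2 / 2) + σ * t)) ∂(gaussianReal 0 1) =
      2 * stdNormalCDF (-(σ / 2)) := by
  have hsplit : (fun t => min 1 (Real.exp (-(σ ^ 2 / 2) + σ * t))) =
      fun t => (Set.Ici (σ / 2)).indicator (fun _ => (1 : ℝ)) t +
        (Set.Iio (σ / 2)).indicator (fun t => Real.exp (-(σ ^ 2 / 2) + σ * t)) t := by
    ext t
    by_cases ht : σ / 2 ≤ t
    · rw [Set.indicator_of_mem (Set.mem_Ici.mpr ht),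
        Set.indicator_of_notMem (by simpa using ht), add_zero, min_eq_left]
      exact Real.one_le_exp (by nlinarith)
    · push Not at ht
      rw [Set.indicator_of_mem (Set.mem_Iio.mpr ht), Set.indicator_of_notMem (by simpa using ht),
        zero_add, min_eq_right]
      exact Real.exp_le_one_iff.mpr (by nlinarith)
  have hexp : Integrable (fun t => Real.exp (-(σ ^ 2 / 2) + σ * t)) (gaussianReal 0 1) := by
    simp_rw [Real.exp_add]
    exact (integrable_exp_mul_gaussianReal σ).const_mul _
  rw [hsplit, integral_add ((integrable_const 1).indicator measurableSet_Ici)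
    (hexp.indicator measurableSet_Iio), integral_indicator measurableSet_Ici]
  have hneg : gaussianReal 0 1 (Set.Ici (σ / 2)) = gaussianReal 0 1 (Set.Iic (-(σ / 2))) := by
    conv_rhs => rw [← neg_zero, ← gaussianReal_map_neg,
      Measure.map_apply measurable_neg measurableSet_Iic]
    congr 1
    ext t
    simp
  have h1 : ∫ _t in Set.Ici (σ / 2), (1 : ℝ) ∂(gaussianReal 0 1) = stdNormalCDF (-(σ / 2)) := by
    rw [setIntegral_const, smul_eq_mul, mul_one, stdNormalCDF, ← hneg]
    rfl
  have hshift : gaussianReal σ 1 (Set.Iio (σ / 2)) = gaussianReal 0 1 (Set.Iic (-(σ / 2))) := by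
    have := gaussianReal_map_add_const (μ := 0) (v := 1) σ
    rw [zero_add] at this
    rw [← this, Measure.map_apply (measurable_add_const σ) measurableSet_Iio]
    have : (fun x => x + σ) ⁻¹' Set.Iio (σ / 2) = Set.Iio (-(σ / 2)) := by
      ext t; simp only [Set.mem_preimage, Set.mem_Iio]
      constructor <;> intro h <;> linarith
    rw [this]
    have hna : NullSingletonClass (gaussianReal 0 1) := nullSingletonClass_gaussianReal one_ne_zero
    exact measure_congr Iio_ae_eq_Iic
  have h2 : ∫ t, (Set.Iio (σ / 2)).indicator (fun t => Real.exp (-(σ ^ 2 / 2) + σ * t)) t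
      ∂(gaussianReal 0 1) = stdNormalCDF (-(σ / 2)) := by
    rw [integral_gaussianReal_eq_integral_smul one_ne_zero, stdNormalCDF, ← hshift,
      gaussianReal_apply_eq_integral σ one_ne_zero, ENNReal.toReal_ofReal
        (integral_nonneg fun _ => gaussianPDFReal_nonneg _ _ _), ← integral_indicator
        measurableSet_Iio]
    refine integral_congr_ae (Eventually.of_forall fun t => ?_)
    by_cases ht : t ∈ Set.Iio (σ / 2)
    · simp only [Set.indicator_of_mem ht, smul_eq_mul, gaussianPDFReal]
      rw [mul_assoc, ← Real.exp_add]
      congr 2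
      simp
      ring
    · simp [Set.indicator_of_notMem ht]
  rw [h1, h2]
  ring

lemma integrable_pow_gaussian (n : ℕ) : Integrable (fun t : ℝ => t ^ n) (gaussianReal 0 1) := by
  have h : MemLp id n (gaussianReal 0 1) := memLp_id_gaussianReal n
  refine (h.integrable_norm_pow').mono' (by fun_prop) (Eventually.of_forall fun t => ?_)
  simp

lemma integral_sq_gaussian : ∫ t, t ^ 2 ∂(gaussianReal 0 1) = 1 := by
  have h := variance_id_gaussianReal (μ := 0) (v := 1)
  rw [variance_eq_sub (memLp_id_gaussianReal 2)] at h
  simpa using h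

end OneDim

section CauchySchwarz

variable {Ω : Type*} {mΩ : MeasurableSpace Ω} {μ : Measure Ω}

lemma integral_mul_le_sqrt_mul_sqrt {X Y : Ω → ℝ} (hX0 : ∀ ω, 0 ≤ X ω) (hY0 : ∀ ω, 0 ≤ Y ω)
    (hX : MemLp X 2 μ) (hY : MemLp Y 2 μ) :
    ∫ ω, X ω * Y ω ∂μ ≤ Real.sqrt (∫ ω, X ω ^ 2 ∂μ) * Real.sqrt (∫ ω, Y ω ^ 2 ∂μ) := by
  have := integral_mul_le_Lp_mul_Lq_of_nonneg Real.HolderConjugate.two_two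
    (Eventually.of_forall hX0) (Eventually.of_forall hY0) (by simpa using hX) (by simpa using hY)
  simpa [Real.sqrt_eq_rpow] using this

lemma integral_abs_le_sqrt [IsProbabilityMeasure μ] {X : Ω → ℝ} (hX : MemLp X 2 μ) :
    ∫ ω, |X ω| ∂μ ≤ Real.sqrt (∫ ω, X ω ^ 2 ∂μ) := by
  have := integral_mul_le_sqrt_mul_sqrt (μ := μ) (X := fun ω => |X ω|) (Y := fun _ => 1)
    (fun _ => abs_nonneg _) (fun _ => zero_le_one) hX.abs (memLp_const 1)
  simpa using this

end CauchySchwarz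

section MultiDim

variable {d : ℕ}

lemma integrable_coord {ψ : ℝ → ℝ} (hψ : Integrable ψ (gaussianReal 0 1)) (i : Fin d) :
    Integrable (fun ξ : Fin d → ℝ => ψ (ξ i)) (stdGauss d) :=
  integrable_comp_eval hψ

lemma integral_coord {ψ : ℝ → ℝ} (hψ : AEStronglyMeasurable ψ (gaussianReal 0 1)) (i : Fin d) :
    ∫ ξ, ψ (ξ i) ∂(stdGauss d) = ∫ t, ψ t ∂(gaussianReal 0 1) := by
  have h := measurePreserving_eval (fun _ : Fin d => gaussianReal 0 1) i
  rw [← h.map_eq, integral_map h.measurable.aemeasurable (by rwa [h.map_eq])]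

lemma memLp_coord {ψ : ℝ → ℝ} (hψ : MemLp ψ 2 (gaussianReal 0 1)) (i : Fin d) :
    MemLp (fun ξ : Fin d → ℝ => ψ (ξ i)) 2 (stdGauss d) :=
  hψ.comp_measurePreserving (measurePreserving_eval _ i)

lemma integral_abs_gaussian_le : ∫ t, |t| ∂(gaussianReal 0 1) ≤ 1 := by
  have := integral_abs_le_sqrt (μ := gaussianReal 0 1) (X := fun t => t) (memLp_id_gaussianReal 2)
  simpa [integral_sq_gaussian] using this

lemma memLp_sq_gaussian : MemLp (fun t : ℝ => t ^ 2) 2 (gaussianReal 0 1) := by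
  rw [memLp_two_iff_integrable_sq (by fun_prop)]
  simpa [← pow_mul] using integrable_pow_gaussian 4

/-- Concentration of a weighted sum of squares of standard Gaussian coordinates. -/
lemma integral_abs_sum_sq_sub_le (p : Fin d → ℝ) :
    ∫ ξ, |∑ i, p i * ξ i ^ 2 - ∑ i, p i| ∂(stdGauss d) ≤
      Real.sqrt ((∫ t, t ^ 4 ∂(gaussianReal 0 1)) * ∑ i, p i ^ 2) := by
  have hX : ∀ i, MemLp (fun t : ℝ => p i * t ^ 2) 2 (gaussianReal 0 1) :=
    fun i => memLp_sq_gaussian.const_mul _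
  have hsum : MemLp (fun ξ : Fin d → ℝ => ∑ i, p i * ξ i ^ 2) 2 (stdGauss d) :=
    memLp_finsetSum _ fun i _ => memLp_coord (hX i) i
  have hmean : ∫ ξ, ∑ i, p i * ξ i ^ 2 ∂(stdGauss d) = ∑ i, p i := by
    rw [integral_finsetSum _ fun i _ => (memLp_coord (hX i) i).integrable one_le_two]
    refine Finset.sum_congr rfl fun i _ => ?_
    rw [integral_coord (ψ := fun t => p i * t ^ 2) (by fun_prop), integral_const_mul,
      integral_sq_gaussian, mul_one]
  have hvar := variance_sum_pi (μ := fun _ : Fin d => gaussianReal 0 1) hX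
  have hfun : (∑ i, fun ω : Fin d → ℝ => p i * ω i ^ 2) = fun ω => ∑ i, p i * ω i ^ 2 := by
    ext ω; simp
  rw [hfun, variance_eq_integral hsum.aestronglyMeasurable.aemeasurable, hmean] at hvar
  refine (integral_abs_le_sqrt (hsum.sub (memLp_const _))).trans (Real.sqrt_le_sqrt ?_)
  refine hvar.le.trans ?_
  rw [Finset.mul_sum]
  refine Finset.sum_le_sum fun i _ => ?_
  refine (variance_le_expectation_sq (hX i).aestronglyMeasurable).trans (le_of_eq ?_)
  rw [← integral_mul_const]
  refine integral_congr_ae (Eventually.of_forall fun t => ?_)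
  simp only [Pi.pow_apply]
  ring

lemma map_sum_stdGauss (b : Fin d → ℝ) :
    (stdGauss d).map (fun ζ => ∑ i, b i * ζ i) = gaussianReal 0 (∑ i, b i ^ 2).toNNReal := by
  have hX : ∀ i, MemLp (fun t : ℝ => b i * t) 2 (gaussianReal 0 1) :=
    fun i => (memLp_id_gaussianReal 2).const_mul _
  have hind : iIndepFun (fun i (ζ : Fin d → ℝ) => b i * ζ i) (stdGauss d) :=
    iIndepFun_pi (X := fun i t => b i * t) fun i => by fun_prop
  have hG : ∀ i, HasGaussianLaw (fun ζ : Fin d → ℝ => b i * ζ i) (stdGauss d) := by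
    intro i
    refine ⟨?_⟩
    have h := measurePreserving_eval (fun _ : Fin d => gaussianReal 0 1) i
    have h2 : (stdGauss d).map (fun ζ => b i * ζ i) =
        (gaussianReal 0 1).map (fun t => b i * t) := by
      rw [← h.map_eq, Measure.map_map (by fun_prop) h.measurable]
      rfl
    rw [h2, gaussianReal_map_const_mul]
    infer_instance
  have hsum := iIndepFun.hasGaussianLaw_fun_sum hG hind
  rw [hsum.map_eq_gaussianReal]
  have hmean : ∫ ζ, ∑ i, b i * ζ i ∂(stdGauss d) = 0 := by
    rw [integral_finsetSum _ fun i _ => (memLp_coord (hX i) i).integrable one_le_two]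
    refine Finset.sum_eq_zero fun i _ => ?_
    rw [integral_coord (ψ := fun t => b i * t) (by fun_prop), integral_const_mul,
      integral_id_gaussianReal, mul_zero]
  have hvar := variance_sum_pi (μ := fun _ : Fin d => gaussianReal 0 1) hX
  have hfun : (∑ i, fun ω : Fin d → ℝ => b i * ω i) = fun ω => ∑ i, b i * ω i := by
    ext ω; simp
  rw [hfun] at hvar
  rw [hmean, hvar]
  congr 2
  refine Finset.sum_congr rfl fun i _ => ?_
  rw [variance_const_mul, variance_fun_id_gaussianReal]
  simp

lemma integral_comp_sum_stdGauss (b : Fin d → ℝ) {H : ℝ → ℝ} (hH : Measurable H) :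
    ∫ ζ, H (∑ i, b i * ζ i) ∂(stdGauss d) =
      ∫ t, H (Real.sqrt (∑ i, b i ^ 2) * t) ∂(gaussianReal 0 1) := by
  have h1 := map_sum_stdGauss b
  have h2 := gaussianReal_map_const_mul (μ := 0) (v := 1) (Real.sqrt (∑ i, b i ^ 2))
  have h3 : NNReal.mk (Real.sqrt (∑ i, b i ^ 2) ^ 2) (sq_nonneg _) * 1 =
      (∑ i, b i ^ 2).toNNReal := by
    ext
    have hnn : 0 ≤ ∑ i, b i ^ 2 := Finset.sum_nonneg fun i _ => sq_nonneg _
    simp [Real.sq_sqrt hnn, hnn]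
  rw [h3, mul_zero, ← h1] at h2
  rw [← integral_map (φ := fun ζ : Fin d → ℝ => ∑ i, b i * ζ i) (f := H)
    (by fun_prop : Measurable fun ζ : Fin d → ℝ => ∑ i, b i * ζ i).aemeasurable
      hH.aestronglyMeasurable, ← h2, integral_map (by fun_prop) hH.aestronglyMeasurable]

end MultiDim

section Core

variable {d : ℕ}

lemma integrable_of_bounded {Ω : Type*} {mΩ : MeasurableSpace Ω} {μ : Measure Ω}
    [IsFiniteMeasure μ] {X : Ω → ℝ} (hX : Measurable X) {M : ℝ} (hM : ∀ ω, |X ω| ≤ M) :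
    Integrable X μ :=
  (integrable_const M).mono' hX.aestronglyMeasurable (Eventually.of_forall hM)

/-- A factor depending on a single coordinate nearly decouples from a Lipschitz function of a
linear form. -/
lemma abs_integral_mul_comp_sum_sub_le {ψ : ℝ → ℝ} (hψ0 : ∀ t, 0 ≤ ψ t) (hψm : Measurable ψ)
    (hψ : MemLp ψ 2 (gaussianReal 0 1)) (hψ1 : ∫ t, ψ t ∂(gaussianReal 0 1) = 1)
    {H : ℝ → ℝ} (hH : Measurable H) (hH1 : ∀ t, |H t| ≤ 1) (hHL : ∀ s t, |H s - H t| ≤ |s - t|)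
    (b : Fin d → ℝ) (i : Fin d) :
    |∫ ζ, ψ (ζ i) * H (∑ j, b j * ζ j) ∂(stdGauss d) - ∫ ζ, H (∑ j, b j * ζ j) ∂(stdGauss d)| ≤
      |b i| * ∫ t, (ψ t + 1) * |t| ∂(gaussianReal 0 1) := by
  set T : (Fin d → ℝ) → ℝ := fun ζ => ∑ j ∈ Finset.univ.erase i, b j * ζ j with hT
  have hTm : Measurable T := by fun_prop
  have hsum : ∀ ζ : Fin d → ℝ, ∑ j, b j * ζ j = b i * ζ i + T ζ := fun ζ =>
    (Finset.add_sum_erase _ _ (Finset.mem_univ i)).symm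
  have hψi : Integrable (fun ζ : Fin d → ℝ => ψ (ζ i)) (stdGauss d) :=
    integrable_coord (hψ.integrable one_le_two) i
  have hindep : IndepFun (fun ζ : Fin d → ℝ => ζ i) T (stdGauss d) := by
    set b' := Function.update b i 1 with hb'
    have h : iIndepFun (fun j (ζ : Fin d → ℝ) => b' j * ζ j) (stdGauss d) :=
      iIndepFun_pi (X := fun j t => b' j * t) fun j => by fun_prop
    have h2 := (h.indepFun_finsetSum_of_notMem (fun j => by fun_prop)
      (Finset.notMem_erase i Finset.univ)).symm
    have e1 : (fun ζ : Fin d → ℝ => b' i * ζ i) = fun ζ => ζ i := by ext; simp [hb']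
    have e2 : (∑ j ∈ Finset.univ.erase i, fun ζ : Fin d → ℝ => b' j * ζ j) = T := by
      ext ζ
      rw [Finset.sum_apply, hT]
      refine Finset.sum_congr rfl fun j hj => ?_
      rw [hb', Function.update_of_ne (Finset.ne_of_mem_erase hj)]
    rwa [e1, e2] at h2
  have hmid : ∫ ζ, ψ (ζ i) * H (T ζ) ∂(stdGauss d) = ∫ ζ, H (T ζ) ∂(stdGauss d) := by
    have h := (hindep.comp hψm hH).integral_fun_mul_eq_mul_integral
      (hψm.comp (measurable_pi_apply i)).aestronglyMeasurable (hH.comp hTm).aestronglyMeasurable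
    simp only [Function.comp_apply] at h
    rw [h, integral_coord hψm.aestronglyMeasurable, hψ1, one_mul]
  have hS : Measurable fun ζ : Fin d → ℝ => b i * ζ i + T ζ := by fun_prop
  have hb : ∀ {Y : (Fin d → ℝ) → ℝ}, Measurable Y →
      Integrable (fun ζ => H (Y ζ)) (stdGauss d) := fun hY =>
    integrable_of_bounded (hH.comp hY) fun ζ => hH1 _
  have hbψ : ∀ {Y : (Fin d → ℝ) → ℝ}, Measurable Y →
      Integrable (fun ζ : Fin d → ℝ => ψ (ζ i) * H (Y ζ)) (stdGauss d) := fun hY =>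
    hψi.mul_bdd (c := 1) (hH.comp hY).aestronglyMeasurable
      (Eventually.of_forall fun ζ => by simpa using hH1 _)
  have hid : MemLp (fun t : ℝ => t) 2 (gaussianReal 0 1) := memLp_id_gaussianReal 2
  have hK : Integrable (fun t : ℝ => (ψ t + 1) * |t|) (gaussianReal 0 1) :=
    (hψ.add (memLp_const 1)).integrable_mul hid.abs
  simp only [hsum]
  have key : (∫ ζ, ψ (ζ i) * H (b i * ζ i + T ζ) ∂(stdGauss d)) -
      ∫ ζ, H (b i * ζ i + T ζ) ∂(stdGauss d) =
      ∫ ζ, (ψ (ζ i) - 1) * (H (b i * ζ i + T ζ) - H (T ζ)) ∂(stdGauss d) := by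
    have : (fun ζ : Fin d → ℝ => (ψ (ζ i) - 1) * (H (b i * ζ i + T ζ) - H (T ζ))) = fun ζ =>
        (ψ (ζ i) * H (b i * ζ i + T ζ) - H (b i * ζ i + T ζ)) -
          (ψ (ζ i) * H (T ζ) - H (T ζ)) := by ext; ring
    have i1 : Integrable (fun ζ : Fin d → ℝ => ψ (ζ i) * H (b i * ζ i + T ζ) -
      H (b i * ζ i + T ζ)) (stdGauss d) := (hbψ hS).sub (hb hS)
    have i2 : Integrable (fun ζ : Fin d → ℝ => ψ (ζ i) * H (T ζ) - H (T ζ)) (stdGauss d) :=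
      (hbψ hTm).sub (hb hTm)
    rw [this, integral_sub i1 i2,
      integral_sub (hbψ hS) (hb hS), integral_sub (hbψ hTm) (hb hTm), hmid, sub_self, sub_zero]
  rw [key]
  refine abs_integral_le_integral_abs.trans ?_
  rw [← integral_coord (ψ := fun t => (ψ t + 1) * |t|) (by fun_prop) i, ← integral_const_mul]
  refine integral_mono_of_nonneg (Eventually.of_forall fun ζ => abs_nonneg _)
    ((integrable_coord hK i).const_mul _) (Eventually.of_forall fun ζ => ?_)
  simp only [abs_mul]
  have h1 : |ψ (ζ i) - 1| ≤ ψ (ζ i) + 1 := by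
    rw [abs_le]; constructor <;> linarith [hψ0 (ζ i)]
  have h2 : |H (b i * ζ i + T ζ) - H (T ζ)| ≤ |b i| * |ζ i| := by
    refine (hHL _ _).trans (le_of_eq ?_)
    rw [add_sub_cancel_right, abs_mul]
  calc |ψ (ζ i) - 1| * |H (b i * ζ i + T ζ) - H (T ζ)|
      ≤ (ψ (ζ i) + 1) * (|b i| * |ζ i|) :=
        mul_le_mul h1 h2 (abs_nonneg _) (by linarith [hψ0 (ζ i)])
    _ = _ := by ring

lemma abs_integral_mul_min_one_exp_sub_le {ψ : ℝ → ℝ} (hψ0 : ∀ t, 0 ≤ ψ t) (hψm : Measurable ψ)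
    (hψ : MemLp ψ 2 (gaussianReal 0 1)) (hψ1 : ∫ t, ψ t ∂(gaussianReal 0 1) = 1)
    {σ : ℝ} (hσ : 0 ≤ σ) (b : Fin d → ℝ) (i : Fin d) :
    |∫ ζ, ψ (ζ i) * min 1 (Real.exp (-(σ ^ 2 / 2) + ∑ j, b j * ζ j)) ∂(stdGauss d) -
        2 * stdNormalCDF (-(σ / 2))| ≤
      |b i| * ∫ t, (ψ t + 1) * |t| ∂(gaussianReal 0 1) + |Real.sqrt (∑ j, b j ^ 2) - σ| := by
  set H : ℝ → ℝ := fun t => min 1 (Real.exp (-(σ ^ 2 / 2) + t)) with hHdef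
  have hH : Measurable H := by fun_prop
  have hH1 : ∀ t, |H t| ≤ 1 := fun t => by
    rw [abs_of_nonneg (min_one_exp_nonneg _)]; exact min_le_left _ _
  have hHL : ∀ s t, |H s - H t| ≤ |s - t| := fun s t => by
    refine (abs_min_one_exp_sub_le _ _).trans ((min_le_right _ _).trans (le_of_eq ?_))
    congr 1; ring
  have h1 := abs_integral_mul_comp_sum_sub_le hψ0 hψm hψ hψ1 hH hH1 hHL b i
  rw [← integral_min_one_exp_gaussian hσ]
  have h2 : |∫ ζ, H (∑ j, b j * ζ j) ∂(stdGauss d) - ∫ t, H (σ * t) ∂(gaussianReal 0 1)| ≤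
      |Real.sqrt (∑ j, b j ^ 2) - σ| := by
    have hi : ∀ v, Integrable (fun t => H (v * t)) (gaussianReal 0 1) := fun v =>
      integrable_of_bounded (hH.comp (measurable_const_mul v)) fun t => hH1 _
    rw [integral_comp_sum_stdGauss b hH, ← integral_sub (hi _) (hi _)]
    refine abs_integral_le_integral_abs.trans ?_
    calc ∫ t, |H (Real.sqrt (∑ j, b j ^ 2) * t) - H (σ * t)| ∂(gaussianReal 0 1)
        ≤ ∫ t, |Real.sqrt (∑ j, b j ^ 2) - σ| * |t| ∂(gaussianReal 0 1) := by
          refine integral_mono_of_nonneg (Eventually.of_forall fun t => abs_nonneg _)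
            (((memLp_id_gaussianReal 1).integrable le_rfl).abs.const_mul _)
            (Eventually.of_forall fun t => (hHL _ _).trans (le_of_eq ?_))
          rw [← sub_mul, abs_mul]
      _ ≤ _ := by
          rw [integral_const_mul]
          exact mul_le_of_le_one_right (abs_nonneg _) integral_abs_gaussian_le
  exact (abs_sub_le _ _ _).trans (add_le_add h1 h2)

/-- The quantitative comparison of a weighted expected acceptance probability with its limit. -/
lemma abs_integral_weight_mul_min_one_exp_sub_le {ψ : ℝ → ℝ} (hψ0 : ∀ t, 0 ≤ ψ t)
    (hψm : Measurable ψ) (hψ : MemLp ψ 2 (gaussianReal 0 1))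
    (hψ1 : ∫ t, ψ t ∂(gaussianReal 0 1) = 1) {f : (Fin d → ℝ) → ℝ} (hfm : Measurable f)
    (hf0 : ∀ ξ, 0 ≤ f ξ) {M : ℝ} (hfM : ∀ ξ, f ξ ≤ M) (hf1 : ∫ ξ, f ξ ∂(stdGauss d) = 1)
    {σ : ℝ} (hσ : 0 ≤ σ) {Z : (Fin d → ℝ) × (Fin d → ℝ) → ℝ} (hZ : Measurable Z)
    (a : Fin d → ℝ) (i : Fin d) :
    |∫ p, f p.1 * (ψ (p.2 i) * min 1 (Real.exp (Z p))) ∂((stdGauss d).prod (stdGauss d)) -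
        2 * stdNormalCDF (-(σ / 2))| ≤
      M * (Real.sqrt (∫ t, ψ t ^ 2 ∂(gaussianReal 0 1)) *
          Real.sqrt (∫ p, min 1 |Z p - (-(σ ^ 2 / 2) + ∑ j, a j * p.1 j * p.2 j)|
            ∂((stdGauss d).prod (stdGauss d)))) +
      M * (|a i| * ∫ t, (ψ t + 1) * |t| ∂(gaussianReal 0 1) +
        ∫ ξ, |Real.sqrt (∑ j, (a j * ξ j) ^ 2) - σ| ∂(stdGauss d)) := by
  set Γ := (stdGauss d).prod (stdGauss d) with hΓ
  set T : (Fin d → ℝ) × (Fin d → ℝ) → ℝ := fun p => -(σ ^ 2 / 2) + ∑ j, a j * p.1 j * p.2 j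
    with hT
  set K := ∫ t, (ψ t + 1) * |t| ∂(gaussianReal 0 1) with hK
  have hTm : Measurable T := by fun_prop
  have hM : 0 ≤ M := (hf0 0).trans (hfM 0)
  have hψL : MemLp (fun p : (Fin d → ℝ) × (Fin d → ℝ) => ψ (p.2 i)) 2 Γ :=
    (memLp_coord hψ i).comp_measurePreserving measurePreserving_snd
  have hψsq : ∫ p, ψ (p.2 i) ^ 2 ∂Γ = ∫ t, ψ t ^ 2 ∂(gaussianReal 0 1) := by
    rw [hΓ, integral_fun_snd (fun ζ : Fin d → ℝ => ψ (ζ i) ^ 2)]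
    simp only [probReal_univ, one_smul]
    exact integral_coord (ψ := fun t => ψ t ^ 2) (by fun_prop) i
  have hInt : ∀ {Y : (Fin d → ℝ) × (Fin d → ℝ) → ℝ}, Measurable Y → (∀ p, |Y p| ≤ 1) →
      Integrable (fun p => f p.1 * (ψ (p.2 i) * Y p)) Γ := by
    intro Y hY hY1
    have h1 : Integrable (fun p => ψ (p.2 i) * Y p) Γ :=
      (hψL.integrable one_le_two).mul_bdd (c := 1) hY.aestronglyMeasurable
        (Eventually.of_forall hY1)
    exact h1.bdd_mul (c := M) (hfm.comp measurable_fst).aestronglyMeasurable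
      (Eventually.of_forall fun p => by
        rw [Real.norm_eq_abs, abs_of_nonneg (hf0 _)]; exact hfM _)
  have hmin : ∀ y : ℝ, |min 1 (Real.exp y)| ≤ 1 := fun y => by
    rw [abs_of_nonneg (min_one_exp_nonneg _)]; exact min_le_left _ _
  have hmZ : Measurable fun p => min 1 (Real.exp (Z p)) := measurable_min_one_exp.comp hZ
  have hmT : Measurable fun p => min 1 (Real.exp (T p)) := measurable_min_one_exp.comp hTm
  have hmW : Measurable fun p => min 1 |Z p - T p| := by fun_prop
  have hW0 : ∀ p, 0 ≤ min 1 |Z p - T p| := fun p => le_min zero_le_one (abs_nonneg _)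
  have hW1 : ∀ p, abs (min 1 |Z p - T p|) ≤ 1 := fun p => by
    rw [abs_of_nonneg (hW0 p)]; exact min_le_left _ _
  have step1 : |∫ p, f p.1 * (ψ (p.2 i) * min 1 (Real.exp (Z p))) ∂Γ -
      ∫ p, f p.1 * (ψ (p.2 i) * min 1 (Real.exp (T p))) ∂Γ| ≤
      M * (Real.sqrt (∫ t, ψ t ^ 2 ∂(gaussianReal 0 1)) *
          Real.sqrt (∫ p, min 1 |Z p - T p| ∂Γ)) := by
    rw [← integral_sub (hInt hmZ fun p => hmin _) (hInt hmT fun p => hmin _)]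
    refine abs_integral_le_integral_abs.trans ?_
    have hψW : Integrable (fun p => ψ (p.2 i) * min 1 |Z p - T p|) Γ :=
      (hψL.integrable one_le_two).mul_bdd (c := 1) hmW.aestronglyMeasurable
        (Eventually.of_forall hW1)
    calc _ ≤ ∫ p, M * (ψ (p.2 i) * min 1 |Z p - T p|) ∂Γ := by
          refine integral_mono_of_nonneg (Eventually.of_forall fun p => abs_nonneg _)
            (hψW.const_mul M) (Eventually.of_forall fun p => ?_)
          simp only
          rw [← mul_sub, ← mul_sub, abs_mul, abs_mul, abs_of_nonneg (hf0 _),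
            abs_of_nonneg (hψ0 _)]
          exact mul_le_mul (hfM _) (mul_le_mul_of_nonneg_left (abs_min_one_exp_sub_le _ _)
            (hψ0 _)) (mul_nonneg (hψ0 _) (abs_nonneg _)) hM
      _ = M * ∫ p, ψ (p.2 i) * min 1 |Z p - T p| ∂Γ := integral_const_mul _ _
      _ ≤ _ := by
          refine mul_le_mul_of_nonneg_left ?_ hM
          refine (integral_mul_le_sqrt_mul_sqrt (fun p => hψ0 _) hW0 hψL
            (MemLp.of_bound hmW.aestronglyMeasurable 1 (Eventually.of_forall hW1))).trans ?_
          rw [hψsq]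
          refine mul_le_mul_of_nonneg_left (Real.sqrt_le_sqrt ?_) (Real.sqrt_nonneg _)
          refine integral_mono_of_nonneg (Eventually.of_forall fun p => sq_nonneg _)
            (integrable_of_bounded hmW hW1) (Eventually.of_forall fun p => ?_)
          simp only
          rw [sq]
          exact mul_le_of_le_one_right (hW0 p) (min_le_left _ _)
  have hfint : Integrable f (stdGauss d) := integrable_of_bounded hfm (M := M) fun ξ => by
    rw [abs_of_nonneg (hf0 ξ)]; exact hfM ξ
  set R : (Fin d → ℝ) → ℝ := fun ξ =>
    |a i * ξ i| * K + |Real.sqrt (∑ j, (a j * ξ j) ^ 2) - σ| with hR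
  have hsqrtL : Integrable (fun ξ : Fin d → ℝ => Real.sqrt (∑ j, (a j * ξ j) ^ 2))
      (stdGauss d) := by
    have hs : Integrable (fun ξ : Fin d → ℝ => 1 + ∑ j, (a j * ξ j) ^ 2) (stdGauss d) := by
      refine (integrable_const _).add (integrable_finsetSum _ fun j _ => ?_)
      have := integrable_coord (d := d) ((integrable_pow_gaussian 2).const_mul (a j ^ 2)) j
      simpa only [mul_pow] using this
    refine hs.mono' (Measurable.sqrt (by fun_prop)).aestronglyMeasurable
      (Eventually.of_forall fun ξ => ?_)
    rw [Real.norm_eq_abs, abs_of_nonneg (Real.sqrt_nonneg _)]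
    have hnn : 0 ≤ ∑ j, (a j * ξ j) ^ 2 := Finset.sum_nonneg fun j _ => sq_nonneg _
    nlinarith [Real.sq_sqrt hnn, Real.sqrt_nonneg (∑ j, (a j * ξ j) ^ 2),
      sq_nonneg (Real.sqrt (∑ j, (a j * ξ j) ^ 2) - 1)]
  have habs : Integrable (fun ξ : Fin d → ℝ => |a i * ξ i|) (stdGauss d) :=
    integrable_coord (((memLp_id_gaussianReal 1).integrable le_rfl).const_mul (a i)).abs i
  have hdiff : Integrable (fun ξ : Fin d → ℝ => |Real.sqrt (∑ j, (a j * ξ j) ^ 2) - σ|)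
      (stdGauss d) := (hsqrtL.sub (integrable_const σ)).abs
  have hRint : Integrable R (stdGauss d) := (habs.mul_const K).add hdiff
  have hK0 : 0 ≤ K := integral_nonneg fun t => mul_nonneg (by linarith [hψ0 t]) (abs_nonneg _)
  have step2 : |∫ p, f p.1 * (ψ (p.2 i) * min 1 (Real.exp (T p))) ∂Γ -
      2 * stdNormalCDF (-(σ / 2))| ≤ M * ∫ ξ, R ξ ∂(stdGauss d) := by
    have hF := hInt hmT fun p => hmin _
    rw [hΓ, integral_prod _ hF]
    have hI := hF.integral_prod_left
    have hc : 2 * stdNormalCDF (-(σ / 2)) =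
        ∫ ξ, f ξ * (2 * stdNormalCDF (-(σ / 2))) ∂(stdGauss d) := by
      rw [integral_mul_const, hf1, one_mul]
    rw [hc, ← integral_sub hI (hfint.mul_const _), ← integral_const_mul]
    refine abs_integral_le_integral_abs.trans ?_
    refine integral_mono_of_nonneg (Eventually.of_forall fun ξ => abs_nonneg _)
      (hRint.const_mul M) (Eventually.of_forall fun ξ => ?_)
    simp only
    rw [integral_const_mul, ← mul_sub, abs_mul, abs_of_nonneg (hf0 ξ)]
    refine mul_le_mul (hfM ξ) ?_ (abs_nonneg _) hM
    exact abs_integral_mul_min_one_exp_sub_le hψ0 hψm hψ hψ1 hσ (fun j => a j * ξ j) i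
  have step3 : ∫ ξ, R ξ ∂(stdGauss d) ≤ |a i| * K +
      ∫ ξ, |Real.sqrt (∑ j, (a j * ξ j) ^ 2) - σ| ∂(stdGauss d) := by
    rw [integral_add (habs.mul_const K) hdiff]
    refine add_le_add ?_ le_rfl
    rw [integral_mul_const]
    refine mul_le_mul_of_nonneg_right ?_ hK0
    simp only [abs_mul]
    rw [integral_const_mul, integral_coord (ψ := fun t => |t|) (by fun_prop) i]
    exact mul_le_of_le_one_right (abs_nonneg _) integral_abs_gaussian_le
  exact (abs_sub_le _ _ _).trans (add_le_add step1
    (step2.trans (mul_le_mul_of_nonneg_left step3 hM)))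

end Core

section Scalars

/-- Eigenvalue of the iteration matrix of `L` steps, for the eigenvalue `x ^ 2` of `A`. -/
def multiGain (L : ℕ) (h x : ℝ) : ℝ := (1 - h / 2 * x ^ 2) ^ L

/-- Eigenvalue of the noise covariance of `L` steps, for the eigenvalue `x ^ 2` of `A`. -/
def multiVar (L : ℕ) (h x : ℝ) : ℝ := h * ∑ j ∈ Finset.range L, ((1 - h / 2 * x ^ 2) ^ j) ^ 2

variable {L : ℕ} {h x : ℝ}

lemma one_sub_multiGain_sq (L : ℕ) (h x : ℝ) :
    1 - multiGain L h x ^ 2 = multiVar L h x * (x ^ 2 - h * x ^ 4 / 4) := by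
  have hg := geom_sum_mul ((1 - h / 2 * x ^ 2) ^ 2) L
  simp only [multiGain, multiVar]
  simp only [← pow_mul, mul_comm 2] at hg
  simp only [← pow_mul]
  rw [pow_mul (1 - h / 2 * x ^ 2) L 2] at *
  linear_combination hg

lemma multiVar_pos (hL : 0 < L) (hh : 0 < h) : 0 < multiVar L h x := by
  refine mul_pos hh (Finset.sum_pos' (fun j _ => sq_nonneg _) ⟨0, by simpa using hL, by simp⟩)

lemma multiGain_nonneg (hx : h * x ^ 2 ≤ 1) : 0 ≤ multiGain L h x :=
  pow_nonneg (by linarith) _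

lemma multiGain_le_one (hh : 0 < h) (hx : h * x ^ 2 ≤ 1) : multiGain L h x ≤ 1 :=
  pow_le_one₀ (by linarith) (by have := mul_nonneg hh.le (sq_nonneg x); linarith)

lemma one_sub_multiGain_le (hx : h * x ^ 2 ≤ 1) : 1 - multiGain L h x ≤ L * (h * x ^ 2) / 2 := by
  have := one_add_mul_le_pow (a := -(h / 2 * x ^ 2)) (by linarith) L
  rw [← sub_eq_add_neg] at this
  simp only [multiGain]
  linarith

lemma one_sub_le_multiGain_sq (hx : h * x ^ 2 ≤ 1) :
    1 - L * (h * x ^ 2) ≤ multiGain L h x ^ 2 := by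
  nlinarith [one_sub_multiGain_le (L := L) hx, sq_nonneg (1 - multiGain L h x)]

lemma multiVar_le (hh : 0 < h) (hx : h * x ^ 2 ≤ 1) : multiVar L h x ≤ h * L := by
  refine mul_le_mul_of_nonneg_left ?_ hh.le
  have h0 := mul_nonneg hh.le (sq_nonneg x)
  calc ∑ j ∈ Finset.range L, ((1 - h / 2 * x ^ 2) ^ j) ^ 2 ≤ ∑ _j ∈ Finset.range L, (1 : ℝ) :=
        Finset.sum_le_sum fun j _ => pow_le_one₀ (pow_nonneg (by linarith) _)
          (pow_le_one₀ (by linarith) (by linarith))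
    _ = L := by simp

lemma mul_multiGain_sq_le_multiVar (hh : 0 < h) (hx : h * x ^ 2 ≤ 1) :
    h * L * multiGain L h x ^ 2 ≤ multiVar L h x := by
  rw [mul_assoc]
  refine mul_le_mul_of_nonneg_left ?_ hh.le
  have h0 := mul_nonneg hh.le (sq_nonneg x)
  calc (L : ℝ) * multiGain L h x ^ 2 = ∑ _j ∈ Finset.range L, multiGain L h x ^ 2 := by simp
    _ ≤ _ := Finset.sum_le_sum fun j hj => by
        refine pow_le_pow_left₀ (multiGain_nonneg hx) ?_ 2
        exact pow_le_pow_of_le_one (by linarith) (by linarith) (Finset.mem_range.mp hj).le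

lemma one_sub_multiGain_sq_le (hx : h * x ^ 2 ≤ 1) :
    1 - multiGain L h x ^ 2 ≤ L * (h * x ^ 2) := by
  have := one_sub_le_multiGain_sq (L := L) hx
  linarith

end Scalars

section Sums

variable {d : ℕ} {L : ℕ} {h η : ℝ} {lam : Fin d → ℝ}

/-- Coefficients of the bilinear part of the log acceptance ratio. -/
def crossCoeff (L : ℕ) (h : ℝ) (x : ℝ) : ℝ :=
  -(h * x ^ 3 * multiGain L h x * Real.sqrt (multiVar L h x)) / 4

/-- Coefficients of `ξ ^ 2` in the log acceptance ratio. -/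
def stateCoeff (L : ℕ) (h : ℝ) (x : ℝ) : ℝ := h * x ^ 2 * (1 - multiGain L h x ^ 2) / 8

/-- Coefficients of `-ζ ^ 2` in the log acceptance ratio. -/
def noiseCoeff (L : ℕ) (h : ℝ) (x : ℝ) : ℝ := h * x ^ 4 * multiVar L h x / 8

lemma crossCoeff_sq (hL : 0 < L) (hh : 0 < h) (x : ℝ) :
    crossCoeff L h x ^ 2 = h ^ 2 * x ^ 6 * (multiGain L h x ^ 2 * multiVar L h x) / 16 := by
  have := Real.sq_sqrt (multiVar_pos (x := x) hL hh).le
  simp only [crossCoeff]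
  linear_combination (h ^ 2 * x ^ 6 * multiGain L h x ^ 2 / 16) * this

lemma stateCoeff_sub_noiseCoeff (L : ℕ) (h x : ℝ) :
    stateCoeff L h x - noiseCoeff L h x = -(h ^ 2 * x ^ 6 * multiVar L h x / 32) := by
  simp only [stateCoeff, noiseCoeff]
  rw [one_sub_multiGain_sq]
  ring

lemma crossCoeff_sq_le (hL : 0 < L) (hh : 0 < h) {x : ℝ} (hx : h * x ^ 2 ≤ 1) :
    crossCoeff L h x ^ 2 ≤ L / 16 * (h ^ 3 * x ^ 6) := by
  rw [crossCoeff_sq hL hh]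
  have h1 : multiGain L h x ^ 2 * multiVar L h x ≤ 1 * (h * L) :=
    mul_le_mul (pow_le_one₀ (multiGain_nonneg hx) (multiGain_le_one hh hx)) (multiVar_le hh hx)
      (multiVar_pos hL hh).le zero_le_one
  have h2 : 0 ≤ h ^ 2 * x ^ 6 := by positivity
  nlinarith [mul_le_mul_of_nonneg_left h1 h2]

lemma le_crossCoeff_sq (hL : 0 < L) (hh : 0 < h) {x : ℝ} (hx : h * x ^ 2 ≤ η) (hη : η ≤ 1) :
    L / 16 * (1 - 2 * L * η) * (h ^ 3 * x ^ 6) ≤ crossCoeff L h x ^ 2 := by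
  rw [crossCoeff_sq hL hh]
  have hx1 := hx.trans hη
  have hL0 : (0 : ℝ) ≤ L := Nat.cast_nonneg L
  set G := multiGain L h x ^ 2 with hG
  have h0 : 0 ≤ G := sq_nonneg _
  have h1 : 1 - L * η ≤ G :=
    (by nlinarith : 1 - L * η ≤ 1 - L * (h * x ^ 2)).trans (one_sub_le_multiGain_sq hx1)
  have h2 : h * L * G ≤ multiVar L h x := mul_multiGain_sq_le_multiVar hh hx1
  have h3 : 1 - 2 * L * η ≤ G * G := by nlinarith [sq_nonneg (1 - G)]
  have h4 : h * L * (1 - 2 * L * η) ≤ G * multiVar L h x := by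
    have := mul_le_mul_of_nonneg_left h2 h0
    have := mul_le_mul_of_nonneg_left h3 (mul_nonneg hh.le hL0)
    nlinarith
  have h5 : 0 ≤ h ^ 2 * x ^ 6 := by positivity
  nlinarith [mul_le_mul_of_nonneg_left h4 h5]

lemma pow_three_mul_le (hh : 0 < h) {x : ℝ} (hx : h * x ^ 2 ≤ η) : h ^ 3 * x ^ 6 ≤ η ^ 3 := by
  have := pow_le_pow_left₀ (mul_nonneg hh.le (sq_nonneg x)) hx 3
  calc h ^ 3 * x ^ 6 = (h * x ^ 2) ^ 3 := by ring
    _ ≤ _ := this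

lemma stateCoeff_nonneg (hh : 0 < h) {x : ℝ} (hx : h * x ^ 2 ≤ 1) : 0 ≤ stateCoeff L h x := by
  have := pow_le_one₀ (n := 2) (multiGain_nonneg (L := L) hx) (multiGain_le_one hh hx)
  have h2 : 0 ≤ 1 - multiGain L h x ^ 2 := by linarith
  unfold stateCoeff
  positivity

lemma sq_le_of_le_mul_sq (hh : 0 < h) {x y : ℝ} (hy0 : 0 ≤ y) (hy : y ≤ L * (h * x ^ 2) ^ 2 / 8)
    (hx : h * x ^ 2 ≤ η) : y ^ 2 ≤ L ^ 2 / 64 * η * (h ^ 3 * x ^ 6) := by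
  have h1 := pow_le_pow_left₀ hy0 hy 2
  refine h1.trans ?_
  have h2 : 0 ≤ (L : ℝ) ^ 2 / 64 * (h ^ 3 * x ^ 6) := by positivity
  nlinarith [mul_le_mul_of_nonneg_left hx h2]

lemma stateCoeff_sq_le (hh : 0 < h) {x : ℝ} (hx : h * x ^ 2 ≤ η) (hη : η ≤ 1) :
    stateCoeff L h x ^ 2 ≤ L ^ 2 / 64 * η * (h ^ 3 * x ^ 6) := by
  refine sq_le_of_le_mul_sq hh (stateCoeff_nonneg hh (hx.trans hη)) ?_ hx
  have := one_sub_multiGain_sq_le (L := L) (hx.trans hη)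
  have h0 := mul_nonneg hh.le (sq_nonneg x)
  unfold stateCoeff
  nlinarith [mul_le_mul_of_nonneg_left this h0]

lemma noiseCoeff_sq_le (hL : 0 < L) (hh : 0 < h) {x : ℝ} (hx : h * x ^ 2 ≤ η) (hη : η ≤ 1) :
    noiseCoeff L h x ^ 2 ≤ L ^ 2 / 64 * η * (h ^ 3 * x ^ 6) := by
  have hv := multiVar_pos (x := x) hL hh
  refine sq_le_of_le_mul_sq hh (by unfold noiseCoeff; positivity) ?_ hx
  have := multiVar_le (L := L) hh (hx.trans hη)
  have h0 : 0 ≤ h * x ^ 4 := by positivity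
  unfold noiseCoeff
  nlinarith [mul_le_mul_of_nonneg_left this h0]

lemma sum_crossCoeff_sq_mem (hL : 0 < L) (hh : 0 < h) (hη : η ≤ 1)
    (hx : ∀ i, h * lam i ^ 2 ≤ η) :
    L / 16 * (1 - 2 * L * η) * (h ^ 3 * ∑ i, lam i ^ 6) ≤ ∑ i, crossCoeff L h (lam i) ^ 2 ∧
    ∑ i, crossCoeff L h (lam i) ^ 2 ≤ L / 16 * (h ^ 3 * ∑ i, lam i ^ 6) := by
  rw [Finset.mul_sum, Finset.mul_sum, Finset.mul_sum]
  exact ⟨Finset.sum_le_sum fun i _ => le_crossCoeff_sq hL hh (hx i) hη,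
    Finset.sum_le_sum fun i _ => crossCoeff_sq_le hL hh ((hx i).trans hη)⟩

lemma sum_crossCoeff_pow_four_le (hL : 0 < L) (hh : 0 < h) (hη : η ≤ 1)
    (hx : ∀ i, h * lam i ^ 2 ≤ η) :
    ∑ i, (crossCoeff L h (lam i) ^ 2) ^ 2 ≤
      L / 16 * η ^ 3 * (L / 16 * (h ^ 3 * ∑ i, lam i ^ 6)) := by
  rw [Finset.mul_sum, Finset.mul_sum, Finset.mul_sum]
  refine Finset.sum_le_sum fun i _ => ?_
  have h1 := crossCoeff_sq_le hL hh ((hx i).trans hη)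
  rw [sq]
  refine mul_le_mul (h1.trans ?_) h1 (sq_nonneg _) ?_
  · exact mul_le_mul_of_nonneg_left (pow_three_mul_le hh (hx i)) (by positivity)
  · have := pow_nonneg ((mul_nonneg hh.le (sq_nonneg (lam i))).trans (hx i)) 3
    positivity

lemma sum_stateCoeff_sub_noiseCoeff_mem (hh : 0 < h) (hη : η ≤ 1)
    (hx : ∀ i, h * lam i ^ 2 ≤ η) :
    -(L / 32 * (h ^ 3 * ∑ i, lam i ^ 6)) ≤
      ∑ i, stateCoeff L h (lam i) - ∑ i, noiseCoeff L h (lam i) ∧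
    ∑ i, stateCoeff L h (lam i) - ∑ i, noiseCoeff L h (lam i) ≤
      -(L / 32 * (1 - L * η) * (h ^ 3 * ∑ i, lam i ^ 6)) := by
  rw [← Finset.sum_sub_distrib, Finset.mul_sum, Finset.mul_sum, Finset.mul_sum,
    ← Finset.sum_neg_distrib, ← Finset.sum_neg_distrib]
  have hL0 : (0 : ℝ) ≤ L := Nat.cast_nonneg L
  refine ⟨Finset.sum_le_sum fun i _ => ?_, Finset.sum_le_sum fun i _ => ?_⟩
  · rw [stateCoeff_sub_noiseCoeff]
    have h1 := multiVar_le (L := L) hh ((hx i).trans hη)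
    have h5 : 0 ≤ h ^ 2 * lam i ^ 6 := by positivity
    nlinarith [mul_le_mul_of_nonneg_left h1 h5]
  · rw [stateCoeff_sub_noiseCoeff]
    have h1 := mul_multiGain_sq_le_multiVar (L := L) hh ((hx i).trans hη)
    have h2 : 1 - L * η ≤ multiGain L h (lam i) ^ 2 :=
      (by nlinarith [hx i] : 1 - L * η ≤ 1 - L * (h * lam i ^ 2)).trans
        (one_sub_le_multiGain_sq ((hx i).trans hη))
    have h3 := mul_le_mul_of_nonneg_left h2 (mul_nonneg hh.le hL0)
    have h5 : 0 ≤ h ^ 2 * lam i ^ 6 := by positivity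
    nlinarith [mul_le_mul_of_nonneg_left (h3.trans h1) h5]

end Sums

section Gauss

variable {d : ℕ} {L : ℕ} {h : ℝ} {lam : Fin d → ℝ}

lemma integrable_sq_coord (p : Fin d → ℝ) :
    Integrable (fun ξ : Fin d → ℝ => ∑ i, p i * ξ i ^ 2) (stdGauss d) :=
  integrable_finsetSum _ fun i _ => (integrable_coord (integrable_pow_gaussian 2) i).const_mul _

lemma integral_sum_mul_sq (p : Fin d → ℝ) :
    ∫ ξ, ∑ i, p i * ξ i ^ 2 ∂(stdGauss d) = ∑ i, p i := by
  rw [integral_finsetSum _ fun i _ =>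
    (integrable_coord (integrable_pow_gaussian 2) i).const_mul _]
  refine Finset.sum_congr rfl fun i _ => ?_
  rw [integral_const_mul, integral_coord (ψ := fun t => t ^ 2) (by fun_prop),
    integral_sq_gaussian, mul_one]

lemma integral_abs_sqrt_sub_le (a : Fin d → ℝ) {σ : ℝ} (hσ : 0 ≤ σ) :
    ∫ ξ, |Real.sqrt (∑ j, (a j * ξ j) ^ 2) - σ| ∂(stdGauss d) ≤
      Real.sqrt (|∑ j, a j ^ 2 - σ ^ 2| +
        Real.sqrt ((∫ t, t ^ 4 ∂(gaussianReal 0 1)) * ∑ j, (a j ^ 2) ^ 2)) := by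
  set X : (Fin d → ℝ) → ℝ := fun ξ => ∑ j, a j ^ 2 * ξ j ^ 2 with hX
  have hXe : ∀ ξ : Fin d → ℝ, ∑ j, (a j * ξ j) ^ 2 = X ξ := fun ξ => by simp [hX, mul_pow]
  have hX0 : ∀ ξ, 0 ≤ X ξ := fun ξ =>
    Finset.sum_nonneg fun j _ => mul_nonneg (sq_nonneg _) (sq_nonneg _)
  have hXi : Integrable X (stdGauss d) := integrable_sq_coord _
  have hXm : Measurable X := by fun_prop
  have hsq : Measurable fun ξ => Real.sqrt (X ξ) - σ := hXm.sqrt.sub_const σ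
  have hpt : ∀ ξ, (Real.sqrt (X ξ) - σ) ^ 2 ≤ |X ξ - σ ^ 2| := by
    intro ξ
    have h1 : X ξ - σ ^ 2 = (Real.sqrt (X ξ) - σ) * (Real.sqrt (X ξ) + σ) := by
      nlinarith [Real.sq_sqrt (hX0 ξ)]
    have hs := Real.sqrt_nonneg (X ξ)
    rw [h1, abs_mul, ← sq_abs, sq]
    refine mul_le_mul_of_nonneg_left ?_ (abs_nonneg _)
    rw [abs_of_nonneg (add_nonneg hs hσ), abs_le]
    constructor <;> linarith
  have hdi : Integrable (fun ξ => |X ξ - σ ^ 2|) (stdGauss d) :=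
    (hXi.sub (integrable_const _)).abs
  have hL2 : MemLp (fun ξ => Real.sqrt (X ξ) - σ) 2 (stdGauss d) := by
    rw [memLp_two_iff_integrable_sq hsq.aestronglyMeasurable]
    refine hdi.mono' (hsq.pow_const 2).aestronglyMeasurable (Eventually.of_forall fun ξ => ?_)
    rw [Real.norm_eq_abs, abs_of_nonneg (sq_nonneg _)]
    exact hpt ξ
  simp only [hXe]
  refine (integral_abs_le_sqrt hL2).trans (Real.sqrt_le_sqrt ?_)
  have hci : Integrable (fun ξ => |X ξ - ∑ j, a j ^ 2|) (stdGauss d) :=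
    (hXi.sub (integrable_const _)).abs
  calc ∫ ξ, (Real.sqrt (X ξ) - σ) ^ 2 ∂(stdGauss d)
      ≤ ∫ ξ, |∑ j, a j ^ 2 - σ ^ 2| + |X ξ - ∑ j, a j ^ 2| ∂(stdGauss d) := by
        refine integral_mono_of_nonneg (Eventually.of_forall fun ξ => sq_nonneg _)
          ((integrable_const _).add hci) (Eventually.of_forall fun ξ => (hpt ξ).trans ?_)
        exact (abs_sub_le _ (∑ j, a j ^ 2) _).trans (add_comm _ _).le
    _ = |∑ j, a j ^ 2 - σ ^ 2| + ∫ ξ, |X ξ - ∑ j, a j ^ 2| ∂(stdGauss d) := by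
        rw [integral_add (integrable_const _) hci]; simp
    _ ≤ _ := by gcongr; exact integral_abs_sum_sq_sub_le fun j => a j ^ 2

/-- The Gaussian part of the log acceptance ratio. -/
def gaussPart (L : ℕ) (h : ℝ) (lam : Fin d → ℝ) (p : (Fin d → ℝ) × (Fin d → ℝ)) : ℝ :=
  ∑ i, stateCoeff L h (lam i) * p.1 i ^ 2 - ∑ i, noiseCoeff L h (lam i) * p.2 i ^ 2 +
    ∑ i, crossCoeff L h (lam i) * p.1 i * p.2 i

lemma logRatioCoord_eq (hL : 0 < L) (hh : 0 < h) (hlam : ∀ i, 0 < lam i)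
    (φ : (Fin d → ℝ) → ℝ) (Q : Matrix (Fin d) (Fin d) ℝ) (m : Fin d → ℝ)
    (p : (Fin d → ℝ) × (Fin d → ℝ)) :
    logRatioCoord φ Q m (fun i => (lam i)⁻¹) (fun i => multiGain L h (lam i))
        (fun i => Real.sqrt (multiVar L h (lam i))) p =
      φ (statePoint Q m (fun i => (lam i)⁻¹) p.1) -
        φ (propPoint Q m (fun i => (lam i)⁻¹) (fun i => multiGain L h (lam i))
          (fun i => Real.sqrt (multiVar L h (lam i))) p) + gaussPart L h lam p := by
  unfold logRatioCoord gaussPart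
  congr 1
  rw [← Finset.sum_sub_distrib, ← Finset.sum_add_distrib]
  refine Finset.sum_congr rfl fun i _ => ?_
  have hv := multiVar_pos (x := lam i) hL hh
  have hs := Real.sq_sqrt hv.le
  have hl := (hlam i).ne'
  have e1 : (1 - multiGain L h (lam i) ^ 2) / Real.sqrt (multiVar L h (lam i)) ^ 2 =
      lam i ^ 2 - h * lam i ^ 4 / 4 := by
    rw [one_sub_multiGain_sq, hs]; field_simp
  have e2 : ((lam i)⁻¹ ^ 2)⁻¹ = lam i ^ 2 := by rw [inv_pow, inv_inv]
  rw [e1, e2]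
  simp only [stateCoeff, noiseCoeff, crossCoeff]
  field_simp
  linear_combination -(8 * h * lam i ^ 4 * p.2 i ^ 2) * hs

lemma integral_abs_gaussPart_sub_le (L : ℕ) (h : ℝ) (lam : Fin d → ℝ) (σ : ℝ) :
    ∫ p, |gaussPart L h lam p -
        (-(σ ^ 2 / 2) + ∑ i, crossCoeff L h (lam i) * p.1 i * p.2 i)|
          ∂((stdGauss d).prod (stdGauss d)) ≤
      |∑ i, stateCoeff L h (lam i) - ∑ i, noiseCoeff L h (lam i) + σ ^ 2 / 2| +
        (Real.sqrt ((∫ t, t ^ 4 ∂(gaussianReal 0 1)) * ∑ i, stateCoeff L h (lam i) ^ 2) +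
        Real.sqrt ((∫ t, t ^ 4 ∂(gaussianReal 0 1)) * ∑ i, noiseCoeff L h (lam i) ^ 2)) := by
  set P := ∑ i, stateCoeff L h (lam i)
  set R := ∑ i, noiseCoeff L h (lam i)
  set X : (Fin d → ℝ) → ℝ := fun ξ => |∑ i, stateCoeff L h (lam i) * ξ i ^ 2 - P| with hX
  set Y : (Fin d → ℝ) → ℝ := fun ξ => |∑ i, noiseCoeff L h (lam i) * ξ i ^ 2 - R| with hY
  have hXi : Integrable X (stdGauss d) := ((integrable_sq_coord _).sub (integrable_const _)).abs
  have hYi : Integrable Y (stdGauss d) := ((integrable_sq_coord _).sub (integrable_const _)).abs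
  have hX' : Integrable (fun p : (Fin d → ℝ) × (Fin d → ℝ) => X p.1)
      ((stdGauss d).prod (stdGauss d)) := hXi.comp_fst _
  have hY' : Integrable (fun p : (Fin d → ℝ) × (Fin d → ℝ) => Y p.2)
      ((stdGauss d).prod (stdGauss d)) := hYi.comp_snd _
  have hXY : Integrable (fun p : (Fin d → ℝ) × (Fin d → ℝ) => X p.1 + Y p.2)
      ((stdGauss d).prod (stdGauss d)) := hX'.add hY'
  calc _ ≤ ∫ p : (Fin d → ℝ) × (Fin d → ℝ), |P - R + σ ^ 2 / 2| + (X p.1 + Y p.2)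
        ∂((stdGauss d).prod (stdGauss d)) := by
        refine integral_mono_of_nonneg (Eventually.of_forall fun p => abs_nonneg _)
          ((integrable_const _).add hXY) (Eventually.of_forall fun p => ?_)
        simp only [gaussPart, hX, hY]
        have e : ∀ u v t : ℝ, u - v + t - (-(σ ^ 2 / 2) + t) =
            (P - R + σ ^ 2 / 2) + ((u - P) - (v - R)) := fun u v t => by ring
        rw [e]
        exact (abs_add_le _ _).trans (add_le_add le_rfl (abs_sub _ _))
    _ = |P - R + σ ^ 2 / 2| + (∫ ξ, X ξ ∂(stdGauss d) + ∫ ξ, Y ξ ∂(stdGauss d)) := by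
        rw [integral_add (integrable_const _) hXY, integral_add hX' hY', integral_fun_fst,
          integral_fun_snd]
        simp
    _ ≤ _ := by
        gcongr
        · exact integral_abs_sum_sq_sub_le _
        · exact integral_abs_sum_sq_sub_le _

end Gauss

section Norms

variable {d : ℕ} {Q : Matrix (Fin d) (Fin d) ℝ} {lam : Fin d → ℝ}

lemma anorm_mulVec_sq (hQ : Qᵀ * Q = 1) (hlam : ∀ i, 0 < lam i) (s : ℝ) (u : Fin d → ℝ) :
    anorm Q (fun i => lam i ^ 2) s (Q *ᵥ u) ^ 2 = ∑ i, lam i ^ (4 * s) * u i ^ 2 := by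
  have hnn : ∀ v : Fin d → ℝ, 0 ≤ v ⬝ᵥ v := fun v =>
    Finset.sum_nonneg fun i _ => mul_self_nonneg _
  have h1 : apow Q (fun i => lam i ^ 2) s *ᵥ (Q *ᵥ u) =
      Q *ᵥ (fun i => (lam i ^ 2) ^ s * u i) := by
    rw [apow, Matrix.mulVec_mulVec, Matrix.mul_assoc, hQ, Matrix.mul_one, ← Matrix.mulVec_mulVec]
    congr 1
    ext i
    rw [Matrix.mulVec_diagonal]
  rw [anorm, Real.sq_sqrt (hnn _), h1, dotProduct_mulVec_orthogonal hQ, dotProduct]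
  refine Finset.sum_congr rfl fun i _ => ?_
  have h2 : lam i ^ (4 * s) = ((lam i ^ 2) ^ s) ^ 2 := by
    rw [← Real.rpow_natCast (lam i) 2, ← Real.rpow_mul (hlam i).le, ← Real.rpow_natCast,
      ← Real.rpow_mul (hlam i).le]
    congr 1; push_cast; ring
  rw [h2]; ring

lemma anorm_nonneg (lam2 : Fin d → ℝ) (s : ℝ) (v : Fin d → ℝ) : 0 ≤ anorm Q lam2 s v :=
  Real.sqrt_nonneg _

lemma measurable_anorm (Q : Matrix (Fin d) (Fin d) ℝ) (lam2 : Fin d → ℝ) (s : ℝ) :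
    Measurable (anorm Q lam2 s) := by
  unfold anorm
  refine Measurable.sqrt (Continuous.measurable ?_)
  unfold dotProduct mulVec dotProduct
  fun_prop

/-- Second moment of `|Q (α ξ + β ζ)|_s`. -/
lemma integral_anorm_sq_le (hQ : Qᵀ * Q = 1) (hlam : ∀ i, 0 < lam i) (s : ℝ) {θ D : ℝ}
    (hθ : 0 ≤ θ) (hD : ∑ i, lam i ^ (4 * s - 2) ≤ D) {α β : Fin d → ℝ}
    (hαβ : ∀ i, (α i ^ 2 + β i ^ 2) * lam i ^ 2 ≤ θ) :
    Integrable (fun p : (Fin d → ℝ) × (Fin d → ℝ) =>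
      anorm Q (fun i => lam i ^ 2) s (Q *ᵥ (α * p.1 + β * p.2)) ^ 2)
      ((stdGauss d).prod (stdGauss d)) ∧
    ∫ p, anorm Q (fun i => lam i ^ 2) s (Q *ᵥ (α * p.1 + β * p.2)) ^ 2
      ∂((stdGauss d).prod (stdGauss d)) ≤ 2 * (θ * D) := by
  simp only [anorm_mulVec_sq hQ hlam, Pi.add_apply, Pi.mul_apply]
  set X : (Fin d → ℝ) → ℝ := fun ξ => ∑ i, (2 * (lam i ^ (4 * s) * α i ^ 2)) * ξ i ^ 2 with hX
  set Y : (Fin d → ℝ) → ℝ := fun ξ => ∑ i, (2 * (lam i ^ (4 * s) * β i ^ 2)) * ξ i ^ 2 with hY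
  have hX' : Integrable (fun p : (Fin d → ℝ) × (Fin d → ℝ) => X p.1)
      ((stdGauss d).prod (stdGauss d)) := (integrable_sq_coord _).comp_fst _
  have hY' : Integrable (fun p : (Fin d → ℝ) × (Fin d → ℝ) => Y p.2)
      ((stdGauss d).prod (stdGauss d)) := (integrable_sq_coord _).comp_snd _
  have hnn : ∀ p : (Fin d → ℝ) × (Fin d → ℝ),
      0 ≤ ∑ i, lam i ^ (4 * s) * (α i * p.1 i + β i * p.2 i) ^ 2 := fun p =>
    Finset.sum_nonneg fun i _ => mul_nonneg (Real.rpow_nonneg (hlam i).le _) (sq_nonneg _)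
  have hpt : ∀ p : (Fin d → ℝ) × (Fin d → ℝ),
      ∑ i, lam i ^ (4 * s) * (α i * p.1 i + β i * p.2 i) ^ 2 ≤ X p.1 + Y p.2 := by
    intro p
    rw [hX, hY, ← Finset.sum_add_distrib]
    refine Finset.sum_le_sum fun i _ => ?_
    have h1 : (α i * p.1 i + β i * p.2 i) ^ 2 ≤
        2 * (α i ^ 2 * p.1 i ^ 2) + 2 * (β i ^ 2 * p.2 i ^ 2) := by
      nlinarith [sq_nonneg (α i * p.1 i - β i * p.2 i)]
    have := mul_le_mul_of_nonneg_left h1 (Real.rpow_nonneg (hlam i).le (4 * s))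
    linarith
  refine ⟨(hX'.add hY').mono' (Measurable.aestronglyMeasurable (by fun_prop))
    (Eventually.of_forall fun p => ?_), ?_⟩
  · rw [Real.norm_eq_abs, abs_of_nonneg (hnn p)]
    exact hpt p
  · refine (integral_mono_of_nonneg (Eventually.of_forall hnn) (hX'.add hY')
      (Eventually.of_forall hpt)).trans ?_
    simp only [Pi.add_apply]
    rw [integral_add hX' hY', integral_fun_fst, integral_fun_snd]
    simp only [probReal_univ, one_smul]
    rw [hX, hY, integral_sum_mul_sq, integral_sum_mul_sq, ← Finset.mul_sum, ← Finset.mul_sum,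
      ← mul_add, ← Finset.sum_add_distrib]
    refine mul_le_mul_of_nonneg_left ?_ zero_le_two
    refine le_trans ?_ (mul_le_mul_of_nonneg_left hD hθ)
    rw [Finset.mul_sum]
    refine Finset.sum_le_sum fun i _ => ?_
    have h2 : lam i ^ (4 * s) = lam i ^ (4 * s - 2) * lam i ^ 2 := by
      rw [← Real.rpow_natCast (lam i) 2, ← Real.rpow_add (hlam i)]
      congr 1; push_cast; ring
    rw [h2]
    have := mul_le_mul_of_nonneg_left (hαβ i) (Real.rpow_nonneg (hlam i).le (4 * s - 2))
    linarith

end Norms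

section Potential

variable {d : ℕ} {Q : Matrix (Fin d) (Fin d) ℝ} {lam : Fin d → ℝ}

lemma statePoint_sub (Q : Matrix (Fin d) (Fin d) ℝ) (m w : Fin d → ℝ)
    (p : (Fin d → ℝ) × (Fin d → ℝ)) : statePoint Q m w p.1 - m = Q *ᵥ (w * p.1 + 0 * p.2) := by
  simp [statePoint, pointOf]

lemma propPoint_sub (Q : Matrix (Fin d) (Fin d) ℝ) (m w g z : Fin d → ℝ)
    (p : (Fin d → ℝ) × (Fin d → ℝ)) :
    propPoint Q m w g z p - m = Q *ᵥ (g * w * p.1 + z * p.2) := by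
  simp [propPoint, pointOf, mul_assoc]

lemma statePoint_sub_propPoint (Q : Matrix (Fin d) (Fin d) ℝ) (m w g z : Fin d → ℝ)
    (p : (Fin d → ℝ) × (Fin d → ℝ)) :
    statePoint Q m w p.1 - propPoint Q m w g z p = Q *ᵥ ((1 - g) * w * p.1 + -z * p.2) := by
  have : (1 - g) * w * p.1 + -z * p.2 = w * p.1 - (g * (w * p.1) + z * p.2) := by ring
  rw [this, Matrix.mulVec_sub]
  simp [statePoint, propPoint, pointOf]

/-- Lower bound for the normalising constant of the target. -/
lemma le_integral_exp_neg (hQ : Qᵀ * Q = 1) (hlam : ∀ i, 0 < lam i) {φ : (Fin d → ℝ) → ℝ}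
    (hφ : Measurable φ) (m : Fin d → ℝ) {m0 s C p D : ℝ} (hC : 0 ≤ C) (hp : 0 ≤ p) (hD0 : 0 ≤ D)
    (hD : ∑ i, lam i ^ (4 * s - 2) ≤ D) (hm0 : ∀ x, m0 ≤ φ x)
    (hgr : ∀ x, |φ x| ≤ C * (1 + anorm Q (fun i => lam i ^ 2) s (x - m) ^ p)) :
    Real.exp (-(C * (1 + (2 * Real.sqrt (D + 1)) ^ p))) / 2 ≤
      ∫ ξ, Real.exp (-(φ (statePoint Q m (fun i => (lam i)⁻¹) ξ))) ∂(stdGauss d) := by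
  set R := 2 * Real.sqrt (D + 1) with hR
  have hR2 : R ^ 2 = 4 * (D + 1) := by
    rw [hR, mul_pow, Real.sq_sqrt (by linarith)]; ring
  have hR0 : 0 < R := by have := Real.sqrt_pos.mpr (by linarith : 0 < D + 1); linarith
  set B := Real.exp (-(C * (1 + R ^ p))) with hB
  have hBpos : 0 < B := Real.exp_pos _
  set w : Fin d → ℝ := fun i => (lam i)⁻¹ with hw
  set N : (Fin d → ℝ) × (Fin d → ℝ) → ℝ := fun q =>
    anorm Q (fun i => lam i ^ 2) s (Q *ᵥ (w * q.1 + 0 * q.2)) with hN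
  obtain ⟨hNi, hNb⟩ := integral_anorm_sq_le (Q := Q) hQ hlam s zero_le_one hD (α := w) (β := 0)
    fun i => by
      have := (hlam i).ne'
      simp only [hw, Pi.zero_apply]
      field_simp
      norm_num
  have hexpm : Measurable fun ξ => Real.exp (-(φ (statePoint Q m w ξ))) :=
    Real.measurable_exp.comp (hφ.comp (measurable_statePoint Q m w)).neg
  have hexpi : Integrable (fun ξ => Real.exp (-(φ (statePoint Q m w ξ)))) (stdGauss d) :=
    integrable_of_bounded hexpm (M := Real.exp (-m0)) fun ξ => by
      rw [abs_of_pos (Real.exp_pos _)]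
      exact Real.exp_le_exp.mpr (neg_le_neg (hm0 _))
  have hexpi' : Integrable (fun q : (Fin d → ℝ) × (Fin d → ℝ) =>
      Real.exp (-(φ (statePoint Q m w q.1)))) ((stdGauss d).prod (stdGauss d)) :=
    hexpi.comp_fst _
  have hfst : ∫ ξ, Real.exp (-(φ (statePoint Q m w ξ))) ∂(stdGauss d) =
      ∫ q : (Fin d → ℝ) × (Fin d → ℝ), Real.exp (-(φ (statePoint Q m w q.1)))
        ∂((stdGauss d).prod (stdGauss d)) := by
    rw [integral_fun_fst fun ξ => Real.exp (-(φ (statePoint Q m w ξ)))]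
    simp
  rw [hfst]
  have hlow : Integrable (fun q => B * (1 - N q ^ 2 / R ^ 2)) ((stdGauss d).prod (stdGauss d)) :=
    ((integrable_const 1).sub (hNi.div_const _)).const_mul _
  calc B / 2 ≤ B * (1 - (2 * (1 * D)) / R ^ 2) := by
        rw [div_eq_mul_one_div]
        refine mul_le_mul_of_nonneg_left ?_ hBpos.le
        rw [hR2, le_sub_comm, div_le_iff₀ (by linarith)]
        linarith
    _ ≤ B * (1 - (∫ q, N q ^ 2 ∂((stdGauss d).prod (stdGauss d))) / R ^ 2) := by
        refine mul_le_mul_of_nonneg_left (sub_le_sub_left ?_ _) hBpos.le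
        exact div_le_div_of_nonneg_right hNb (sq_nonneg _)
    _ = ∫ q, B * (1 - N q ^ 2 / R ^ 2) ∂((stdGauss d).prod (stdGauss d)) := by
        rw [integral_const_mul, integral_sub (integrable_const 1) (hNi.div_const _),
          integral_div]
        simp only [integral_const, probReal_univ, smul_eq_mul, mul_one, hN]
    _ ≤ _ := by
        refine integral_mono hlow hexpi' fun q => ?_
        simp only
        have hN0 : 0 ≤ N q := anorm_nonneg _ _ _
        rcases le_or_gt (N q) R with h | h
        · have h1 : B * (1 - N q ^ 2 / R ^ 2) ≤ B :=
            mul_le_of_le_one_right hBpos.le (by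
              have : 0 ≤ N q ^ 2 / R ^ 2 := by positivity
              linarith)
          refine h1.trans (Real.exp_le_exp.mpr (neg_le_neg ?_))
          refine (le_abs_self _).trans ((hgr _).trans ?_)
          rw [statePoint_sub]
          exact mul_le_mul_of_nonneg_left (add_le_add le_rfl (Real.rpow_le_rpow hN0 h hp)) hC
        · have h1 : 1 ≤ N q ^ 2 / R ^ 2 := by
            rw [le_div_iff₀ (by positivity), one_mul]
            exact pow_le_pow_left₀ hR0.le h.le 2
          exact (mul_nonpos_of_nonneg_of_nonpos hBpos.le (by linarith)).trans (Real.exp_pos _).le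

lemma weight_le {φ : (Fin d → ℝ) → ℝ} {m w : Fin d → ℝ} {m0 ε : ℝ} (hε : 0 < ε)
    (hm0 : ∀ x, m0 ≤ φ x)
    (hZ : ε ≤ ∫ ξ, Real.exp (-(φ (statePoint Q m w ξ))) ∂(stdGauss d)) (ξ : Fin d → ℝ) :
    weight φ Q m w ξ ≤ Real.exp (-m0) / ε :=
  div_le_div₀ (Real.exp_pos _).le (Real.exp_le_exp.mpr (neg_le_neg (hm0 _))) hε hZ

lemma integral_weight {φ : (Fin d → ℝ) → ℝ} {m w : Fin d → ℝ}
    (hZ : 0 < ∫ ξ, Real.exp (-(φ (statePoint Q m w ξ))) ∂(stdGauss d)) :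
    ∫ ξ, weight φ Q m w ξ ∂(stdGauss d) = 1 := by
  unfold weight
  rw [integral_div, div_self hZ.ne']

/-- The potential hardly changes between the current state and the proposal. -/
lemma integral_min_one_abs_potential_le (hQ : Qᵀ * Q = 1) (hlam : ∀ i, 0 < lam i)
    {φ : (Fin d → ℝ) → ℝ} (m : Fin d → ℝ) {s s' D D' K R θ θ' : ℝ}
    (hR : 0 < R) (hθ : 0 ≤ θ) (hθ' : 0 ≤ θ')
    (hD : ∑ i, lam i ^ (4 * s - 2) ≤ D) (hD' : ∑ i, lam i ^ (4 * s' - 2) ≤ D')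
    {δf : ℝ → ℝ → ℝ} (hδ0 : ∀ a b, 0 ≤ δf a b) (hδ : ∀ a b, |a| ≤ R → |b| ≤ R → δf a b ≤ K)
    (hLip : ∀ x y, |φ x - φ y| ≤ δf (anorm Q (fun i => lam i ^ 2) s (x - m))
      (anorm Q (fun i => lam i ^ 2) s (y - m)) * anorm Q (fun i => lam i ^ 2) s' (x - y))
    {w g z : Fin d → ℝ} (hw : ∀ i, w i = (lam i)⁻¹)
    (hy : ∀ i, ((g i * w i) ^ 2 + z i ^ 2) * lam i ^ 2 ≤ θ)
    (hxy : ∀ i, (((1 - g i) * w i) ^ 2 + (-z i) ^ 2) * lam i ^ 2 ≤ θ') :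
    ∫ p, min 1 |φ (statePoint Q m w p.1) - φ (propPoint Q m w g z p)|
        ∂((stdGauss d).prod (stdGauss d)) ≤
      K * Real.sqrt (2 * (θ' * D')) + 2 * ((1 + θ) * D) / R ^ 2 := by
  set Γ := (stdGauss d).prod (stdGauss d) with hΓ
  have hK : 0 ≤ K := (hδ0 0 0).trans (hδ 0 0 (by simpa using hR.le) (by simpa using hR.le))
  obtain ⟨hxi, hxb⟩ := integral_anorm_sq_le (Q := Q) hQ hlam s zero_le_one hD (α := w) (β := 0)
    fun i => by
      have := (hlam i).ne'
      simp only [hw, Pi.zero_apply]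
      field_simp
      norm_num
  obtain ⟨hyi, hyb⟩ := integral_anorm_sq_le (Q := Q) hQ hlam s hθ hD (α := g * w) (β := z) hy
  obtain ⟨hdi, hdb⟩ := integral_anorm_sq_le (Q := Q) hQ hlam s' hθ' hD'
    (α := (1 - g) * w) (β := -z) hxy
  have hmul : Measurable fun v : Fin d → ℝ => Q *ᵥ v :=
    Continuous.measurable (by unfold mulVec dotProduct; fun_prop)
  have hdm : Measurable fun p : (Fin d → ℝ) × (Fin d → ℝ) =>
      anorm Q (fun i => lam i ^ 2) s' (Q *ᵥ ((1 - g) * w * p.1 + -z * p.2)) :=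
    (measurable_anorm Q _ s').comp (hmul.comp (by fun_prop))
  set Nx : (Fin d → ℝ) × (Fin d → ℝ) → ℝ := fun p =>
    anorm Q (fun i => lam i ^ 2) s (Q *ᵥ (w * p.1 + 0 * p.2)) with hNx
  set Ny : (Fin d → ℝ) × (Fin d → ℝ) → ℝ := fun p =>
    anorm Q (fun i => lam i ^ 2) s (Q *ᵥ (g * w * p.1 + z * p.2)) with hNy
  set Nd : (Fin d → ℝ) × (Fin d → ℝ) → ℝ := fun p =>
    anorm Q (fun i => lam i ^ 2) s' (Q *ᵥ ((1 - g) * w * p.1 + -z * p.2)) with hNd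
  have hdL : MemLp Nd 2 Γ := by
    rw [memLp_two_iff_integrable_sq hdm.aestronglyMeasurable]
    exact hdi
  have hdI : Integrable Nd Γ := hdL.integrable one_le_two
  have hsum : Integrable (fun p => Nx p ^ 2 / R ^ 2 + Ny p ^ 2 / R ^ 2) Γ :=
    (hxi.div_const _).add (hyi.div_const _)
  have hbound : ∀ p : (Fin d → ℝ) × (Fin d → ℝ),
      min 1 |φ (statePoint Q m w p.1) - φ (propPoint Q m w g z p)| ≤
        K * Nd p + (Nx p ^ 2 / R ^ 2 + Ny p ^ 2 / R ^ 2) := by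
    intro p
    have hx0 : 0 ≤ Nx p := anorm_nonneg _ _ _
    have hy0 : 0 ≤ Ny p := anorm_nonneg _ _ _
    have hd0 : 0 ≤ Nd p := anorm_nonneg _ _ _
    have hx2 : 0 ≤ Nx p ^ 2 / R ^ 2 := by positivity
    have hy2 : 0 ≤ Ny p ^ 2 / R ^ 2 := by positivity
    have hkd : 0 ≤ K * Nd p := mul_nonneg hK hd0
    have hbig : ∀ t : ℝ, R < t → 1 ≤ t ^ 2 / R ^ 2 := fun t ht => by
      rw [le_div_iff₀ (by positivity), one_mul]
      exact pow_le_pow_left₀ hR.le ht.le 2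
    rcases lt_or_ge R (Nx p) with h1 | h1
    · exact (min_le_left _ _).trans (by linarith [hbig _ h1])
    rcases lt_or_ge R (Ny p) with h2 | h2
    · exact (min_le_left _ _).trans (by linarith [hbig _ h2])
    refine (min_le_right _ _).trans ((hLip _ _).trans ?_)
    rw [statePoint_sub, propPoint_sub, statePoint_sub_propPoint]
    have := mul_le_mul_of_nonneg_right
      (hδ (Nx p) (Ny p) (by rwa [abs_of_nonneg hx0]) (by rwa [abs_of_nonneg hy0])) hd0
    linarith
  calc _ ≤ ∫ p, K * Nd p + (Nx p ^ 2 / R ^ 2 + Ny p ^ 2 / R ^ 2) ∂Γ :=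
        integral_mono_of_nonneg (Eventually.of_forall fun p => le_min zero_le_one (abs_nonneg _))
          ((hdI.const_mul K).add hsum) (Eventually.of_forall hbound)
    _ = K * ∫ p, Nd p ∂Γ + ((∫ p, Nx p ^ 2 ∂Γ) / R ^ 2 + (∫ p, Ny p ^ 2 ∂Γ) / R ^ 2) := by
        rw [integral_add (hdI.const_mul K) hsum,
          integral_add (hxi.div_const _) (hyi.div_const _), integral_const_mul, integral_div,
          integral_div]
    _ ≤ K * Real.sqrt (2 * (θ' * D')) + (2 * (1 * D) / R ^ 2 + 2 * (θ * D) / R ^ 2) := by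
        have h1 : ∫ p, Nd p ∂Γ ≤ Real.sqrt (2 * (θ' * D')) := by
          have h := integral_abs_le_sqrt hdL
          have e : (fun p => |Nd p|) = Nd := by
            ext p; exact abs_of_nonneg (anorm_nonneg _ _ _)
          rw [e] at h
          exact h.trans (Real.sqrt_le_sqrt hdb)
        gcongr
    _ = _ := by ring

end Potential

section Jump

variable {d : ℕ}

lemma abs_integral_weight_sq_sub_le {f : (Fin d → ℝ) → ℝ} (hfm : Measurable f)
    (hf0 : ∀ ξ, 0 ≤ f ξ) {M : ℝ} (hfM : ∀ ξ, f ξ ≤ M)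
    {α : (Fin d → ℝ) × (Fin d → ℝ) → ℝ} (hα : Measurable α) (hα0 : ∀ p, 0 ≤ α p)
    (hα1 : ∀ p, α p ≤ 1) {u v : ℝ} (hu : 0 ≤ u) (hv : 0 ≤ v) (i : Fin d) :
    |∫ p, f p.1 * ((u * p.2 i - v * p.1 i) ^ 2 * α p) ∂((stdGauss d).prod (stdGauss d)) -
        u ^ 2 * ∫ p, f p.1 * (p.2 i ^ 2 * α p) ∂((stdGauss d).prod (stdGauss d))| ≤
      M * (2 * u * v + v ^ 2) := by
  set Γ := (stdGauss d).prod (stdGauss d) with hΓ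
  have hM : 0 ≤ M := (hf0 0).trans (hfM 0)
  have hfb : ∀ p : (Fin d → ℝ) × (Fin d → ℝ), ‖f p.1‖ ≤ M := fun p => by
    rw [Real.norm_eq_abs, abs_of_nonneg (hf0 _)]; exact hfM _
  have hid : MemLp (fun t : ℝ => t) 2 (gaussianReal 0 1) := memLp_id_gaussianReal 2
  have h1 : MemLp (fun p : (Fin d → ℝ) × (Fin d → ℝ) => p.1 i) 2 Γ :=
    (memLp_coord hid i).comp_measurePreserving measurePreserving_fst
  have h2 : MemLp (fun p : (Fin d → ℝ) × (Fin d → ℝ) => p.2 i) 2 Γ :=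
    (memLp_coord hid i).comp_measurePreserving measurePreserving_snd
  have hInt : ∀ {Y : (Fin d → ℝ) × (Fin d → ℝ) → ℝ}, Integrable Y Γ →
      Integrable (fun p => f p.1 * (Y p * α p)) Γ := by
    intro Y hY
    have hY1 : Integrable (fun p => Y p * α p) Γ :=
      hY.mul_bdd (c := 1) hα.aestronglyMeasurable (Eventually.of_forall fun p => by
        rw [Real.norm_eq_abs, abs_of_nonneg (hα0 p)]; exact hα1 p)
    exact hY1.bdd_mul (c := M) (hfm.comp measurable_fst).aestronglyMeasurable
      (Eventually.of_forall hfb)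
  have hi22 : Integrable (fun p : (Fin d → ℝ) × (Fin d → ℝ) => p.2 i ^ 2) Γ := h2.integrable_sq
  have hi11 : Integrable (fun p : (Fin d → ℝ) × (Fin d → ℝ) => p.1 i ^ 2) Γ := h1.integrable_sq
  have hiab : Integrable (fun p : (Fin d → ℝ) × (Fin d → ℝ) => |p.1 i| * |p.2 i|) Γ :=
    h1.abs.integrable_mul h2.abs
  have hia : Integrable (fun p : (Fin d → ℝ) × (Fin d → ℝ) => (u * p.2 i - v * p.1 i) ^ 2) Γ :=
    ((h2.const_mul u).sub (h1.const_mul v)).integrable_sq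
  have hbd : Integrable (fun p : (Fin d → ℝ) × (Fin d → ℝ) =>
      M * (2 * u * v * (|p.1 i| * |p.2 i|) + v ^ 2 * p.1 i ^ 2)) Γ :=
    ((hiab.const_mul _).add (hi11.const_mul _)).const_mul _
  rw [← integral_const_mul, ← integral_sub (hInt hia) ((hInt hi22).const_mul _)]
  refine abs_integral_le_integral_abs.trans ?_
  calc _ ≤ ∫ p : (Fin d → ℝ) × (Fin d → ℝ),
          M * (2 * u * v * (|p.1 i| * |p.2 i|) + v ^ 2 * p.1 i ^ 2) ∂Γ := by
        refine integral_mono_of_nonneg (Eventually.of_forall fun p => abs_nonneg _) hbd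
          (Eventually.of_forall fun p => ?_)
        simp only
        have e : f p.1 * ((u * p.2 i - v * p.1 i) ^ 2 * α p) - u ^ 2 * (f p.1 * (p.2 i ^ 2 * α p))
            = f p.1 * ((v ^ 2 * p.1 i ^ 2 - 2 * u * v * (p.1 i * p.2 i)) * α p) := by ring
        rw [e, abs_mul, abs_of_nonneg (hf0 _), abs_mul, abs_of_nonneg (hα0 p)]
        refine mul_le_mul (hfM _) ?_ (mul_nonneg (abs_nonneg _) (hα0 p)) hM
        refine (mul_le_of_le_one_right (abs_nonneg _) (hα1 p)).trans ?_
        refine (abs_sub _ _).trans ?_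
        rw [abs_mul (2 * u * v), abs_mul (p.1 i), abs_of_nonneg (by positivity : 0 ≤ 2 * u * v),
          abs_of_nonneg (by positivity : 0 ≤ v ^ 2 * p.1 i ^ 2)]
        exact (add_comm _ _).le
    _ = M * (2 * u * v * ((∫ t, |t| ∂(gaussianReal 0 1)) * ∫ t, |t| ∂(gaussianReal 0 1)) +
          v ^ 2) := by
        rw [integral_const_mul, integral_add (hiab.const_mul _) (hi11.const_mul _),
          integral_const_mul, integral_const_mul,
          integral_prod_mul (fun ξ : Fin d → ℝ => |ξ i|) (fun ξ : Fin d → ℝ => |ξ i|),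
          integral_fun_fst (fun ξ : Fin d → ℝ => ξ i ^ 2),
          integral_coord (ψ := fun t => |t|) (by fun_prop) i,
          integral_coord (ψ := fun t => t ^ 2) (by fun_prop) i, integral_sq_gaussian]
        simp
    _ ≤ _ := by
        refine mul_le_mul_of_nonneg_left (add_le_add ?_ le_rfl) hM
        refine mul_le_of_le_one_right (by positivity) ?_
        exact mul_le_one₀ integral_abs_gaussian_le (integral_nonneg fun t => abs_nonneg _)
          integral_abs_gaussian_le

end Jump

section Limits

variable {L : ℕ} {h η : ℕ → ℝ} {lam : (d : ℕ) → Fin d → ℝ} {B : ℝ}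

lemma tendsto_sum_crossCoeff_sq (hL : 0 < L) (hη : Tendsto η atTop (𝓝 0))
    (hev : ∀ᶠ d in atTop, 0 < h d ∧ η d ≤ 1 ∧ ∀ i, h d * lam d i ^ 2 ≤ η d)
    (hB : Tendsto (fun d => h d ^ 3 * ∑ i, lam d i ^ 6) atTop (𝓝 B)) :
    Tendsto (fun d => ∑ i, crossCoeff L (h d) (lam d i) ^ 2) atTop (𝓝 (L / 16 * B)) := by
  refine tendsto_of_tendsto_of_tendsto_of_le_of_le'
    (g := fun d => L / 16 * (1 - 2 * L * η d) * (h d ^ 3 * ∑ i, lam d i ^ 6))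
    (h := fun d => L / 16 * (h d ^ 3 * ∑ i, lam d i ^ 6)) ?_ (hB.const_mul _) ?_ ?_
  · have := (((hη.const_mul (2 * (L : ℝ))).const_sub 1).const_mul ((L : ℝ) / 16)).mul hB
    simpa using this
  · filter_upwards [hev] with d hd
    exact (sum_crossCoeff_sq_mem hL hd.1 hd.2.1 hd.2.2).1
  · filter_upwards [hev] with d hd
    exact (sum_crossCoeff_sq_mem hL hd.1 hd.2.1 hd.2.2).2

lemma tendsto_sqrt_error (hL : 0 < L) (hη : Tendsto η atTop (𝓝 0))
    (hev : ∀ᶠ d in atTop, 0 < h d ∧ η d ≤ 1 ∧ ∀ i, h d * lam d i ^ 2 ≤ η d)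
    (hB : Tendsto (fun d => h d ^ 3 * ∑ i, lam d i ^ 6) atTop (𝓝 B))
    {σ : ℝ} (hσ : 0 ≤ σ) (hσB : σ ^ 2 = L / 16 * B) :
    Tendsto (fun d => ∫ ξ, |Real.sqrt (∑ j, (crossCoeff L (h d) (lam d j) * ξ j) ^ 2) - σ|
      ∂(stdGauss d)) atTop (𝓝 0) := by
  have h4 : Tendsto (fun d => ∑ i, (crossCoeff L (h d) (lam d i) ^ 2) ^ 2) atTop (𝓝 0) := by
    refine tendsto_of_tendsto_of_tendsto_of_le_of_le' tendsto_const_nhds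
      (h := fun d => L / 16 * η d ^ 3 * (L / 16 * (h d ^ 3 * ∑ i, lam d i ^ 6))) ?_
      (Eventually.of_forall fun d => Finset.sum_nonneg fun i _ => sq_nonneg _) ?_
    · have := ((hη.pow 3).const_mul ((L : ℝ) / 16)).mul (hB.const_mul ((L : ℝ) / 16))
      simpa using this
    · filter_upwards [hev] with d hd
      exact sum_crossCoeff_pow_four_le hL hd.1 hd.2.1 hd.2.2
  have h2 := (tendsto_sum_crossCoeff_sq hL hη hev hB).sub_const (σ ^ 2)
  rw [hσB, sub_self] at h2
  have hlim := (h2.abs.add (h4.const_mul (∫ t, t ^ 4 ∂(gaussianReal 0 1))).sqrt).sqrt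
  simp only [abs_zero, mul_zero, Real.sqrt_zero, add_zero] at hlim
  refine squeeze_zero (fun d => integral_nonneg fun ξ => abs_nonneg _) (fun d => ?_) hlim
  have := integral_abs_sqrt_sub_le (fun j => crossCoeff L (h d) (lam d j)) hσ
  rwa [hσB] at this

lemma tendsto_gaussPart_error (hL : 0 < L) (hη : Tendsto η atTop (𝓝 0))
    (hev : ∀ᶠ d in atTop, 0 < h d ∧ η d ≤ 1 ∧ ∀ i, h d * lam d i ^ 2 ≤ η d)
    (hB : Tendsto (fun d => h d ^ 3 * ∑ i, lam d i ^ 6) atTop (𝓝 B))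
    {σ : ℝ} (hσB : σ ^ 2 = L / 16 * B) :
    Tendsto (fun d => ∫ p, |gaussPart L (h d) (lam d) p -
        (-(σ ^ 2 / 2) + ∑ i, crossCoeff L (h d) (lam d i) * p.1 i * p.2 i)|
          ∂((stdGauss d).prod (stdGauss d))) atTop (𝓝 0) := by
  have hsq : ∀ c : ℕ → ℝ → ℝ, (∀ᶠ d in atTop, ∀ i, c d (lam d i) ^ 2 ≤
      L ^ 2 / 64 * η d * (h d ^ 3 * lam d i ^ 6)) →
      Tendsto (fun d => ∑ i, c d (lam d i) ^ 2) atTop (𝓝 0) := by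
    intro c hc
    refine tendsto_of_tendsto_of_tendsto_of_le_of_le' tendsto_const_nhds
      (h := fun d => L ^ 2 / 64 * η d * (h d ^ 3 * ∑ i, lam d i ^ 6)) ?_
      (Eventually.of_forall fun d => Finset.sum_nonneg fun i _ => sq_nonneg _) ?_
    · have := (hη.const_mul ((L : ℝ) ^ 2 / 64)).mul hB
      simpa using this
    · filter_upwards [hc] with d hd
      rw [Finset.mul_sum, Finset.mul_sum]
      exact Finset.sum_le_sum fun i _ => hd i
  have hp := hsq (fun d => stateCoeff L (h d)) (by
    filter_upwards [hev] with d hd i using stateCoeff_sq_le hd.1 (hd.2.2 i) hd.2.1)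
  have hq := hsq (fun d => noiseCoeff L (h d)) (by
    filter_upwards [hev] with d hd i using noiseCoeff_sq_le hL hd.1 (hd.2.2 i) hd.2.1)
  have hpq : Tendsto (fun d => ∑ i, stateCoeff L (h d) (lam d i) -
      ∑ i, noiseCoeff L (h d) (lam d i)) atTop (𝓝 (-(L / 32 * B))) := by
    refine tendsto_of_tendsto_of_tendsto_of_le_of_le'
      (g := fun d => -(L / 32 * (h d ^ 3 * ∑ i, lam d i ^ 6)))
      (h := fun d => -(L / 32 * (1 - L * η d) * (h d ^ 3 * ∑ i, lam d i ^ 6)))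
      (hB.const_mul _).neg ?_ ?_ ?_
    · have := ((((hη.const_mul (L : ℝ)).const_sub 1).const_mul ((L : ℝ) / 32)).mul hB).neg
      simpa using this
    · filter_upwards [hev] with d hd
      exact (sum_stateCoeff_sub_noiseCoeff_mem hd.1 hd.2.1 hd.2.2).1
    · filter_upwards [hev] with d hd
      exact (sum_stateCoeff_sub_noiseCoeff_mem hd.1 hd.2.1 hd.2.2).2
  have h1 := hpq.add_const (σ ^ 2 / 2)
  have e : -((L : ℝ) / 32 * B) + σ ^ 2 / 2 = 0 := by rw [hσB]; ring
  rw [e] at h1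
  have hlim := h1.abs.add ((hp.const_mul (∫ t, t ^ 4 ∂(gaussianReal 0 1))).sqrt.add
    (hq.const_mul (∫ t, t ^ 4 ∂(gaussianReal 0 1))).sqrt)
  simp only [abs_zero, mul_zero, Real.sqrt_zero, add_zero] at hlim
  exact squeeze_zero (fun d => integral_nonneg fun p => abs_nonneg _)
    (fun d => integral_abs_gaussPart_sub_le L (h d) (lam d) σ) hlim

variable {Q : (d : ℕ) → Matrix (Fin d) (Fin d) ℝ} {φ : (d : ℕ) → (Fin d → ℝ) → ℝ}
  {m : (d : ℕ) → Fin d → ℝ}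

lemma multiGain_multiVar_bounds {L : ℕ} {h η x : ℝ} (hL : 0 < L) (hh : 0 < h) (hx0 : 0 < x)
    (hx : h * x ^ 2 ≤ η) (hη : η ≤ 1) :
    ((multiGain L h x * x⁻¹) ^ 2 + Real.sqrt (multiVar L h x) ^ 2) * x ^ 2 ≤ 1 + L ∧
    (((1 - multiGain L h x) * x⁻¹) ^ 2 + (-Real.sqrt (multiVar L h x)) ^ 2) * x ^ 2 ≤
      (L ^ 2 / 4 + L) * η := by
  have hx1 := hx.trans hη
  have hL0 : (0 : ℝ) ≤ L := Nat.cast_nonneg L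
  have ht : 0 ≤ h * x ^ 2 := by positivity
  have hv := Real.sq_sqrt (multiVar_pos (x := x) hL hh).le
  have hS : multiVar L h x * x ^ 2 ≤ L * (h * x ^ 2) := by
    have := mul_le_mul_of_nonneg_right (multiVar_le (L := L) hh hx1) (sq_nonneg x)
    linarith
  have hinv : ∀ t : ℝ, (t * x⁻¹) ^ 2 * x ^ 2 = t ^ 2 := fun t => by
    field_simp
  have hg1 := multiGain_le_one (L := L) hh hx1
  have hg2 := one_sub_multiGain_le (L := L) hx1
  rw [neg_sq, add_mul, add_mul, hinv, hinv, hv]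
  constructor
  · have := pow_le_one₀ (n := 2) (multiGain_nonneg (L := L) hx1) hg1
    nlinarith [mul_le_mul_of_nonneg_left hx1 hL0]
  · have h1 := pow_le_pow_left₀ (by linarith) hg2 2
    have h2 : (h * x ^ 2) ^ 2 ≤ h * x ^ 2 := by nlinarith
    nlinarith [mul_le_mul_of_nonneg_left h2 (sq_nonneg (L : ℝ)),
      mul_le_mul_of_nonneg_left hx (by positivity : (0 : ℝ) ≤ L ^ 2 / 4 + L)]

lemma tendsto_potential_error (hL : 0 < L) (hη : Tendsto η atTop (𝓝 0))
    (hev : ∀ᶠ d in atTop, 0 < h d ∧ η d ≤ 1 ∧ ∀ i, h d * lam d i ^ 2 ≤ η d)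
    (hη0 : ∀ d, 0 ≤ η d) (hQ : ∀ d, (Q d)ᵀ * Q d = 1) (hlam : ∀ d i, 0 < lam d i)
    {s s' D D' : ℝ}
    (hD : ∀ d, ∑ i, lam d i ^ (4 * s - 2) ≤ D) (hD' : ∀ d, ∑ i, lam d i ^ (4 * s' - 2) ≤ D')
    {δf : ℝ → ℝ → ℝ} (hδ0 : ∀ a b, 0 ≤ δf a b)
    (hδ : ∀ R : ℝ, ∃ K : ℝ, ∀ a b, |a| ≤ R → |b| ≤ R → δf a b ≤ K)
    (hLip : ∀ᶠ d in atTop, ∀ x y, |φ d x - φ d y| ≤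
      δf (anorm (Q d) (fun i => lam d i ^ 2) s (x - m d))
        (anorm (Q d) (fun i => lam d i ^ 2) s (y - m d)) *
          anorm (Q d) (fun i => lam d i ^ 2) s' (x - y)) :
    Tendsto (fun d => ∫ p, min 1 |φ d (statePoint (Q d) (m d) (fun i => (lam d i)⁻¹) p.1) -
        φ d (propPoint (Q d) (m d) (fun i => (lam d i)⁻¹) (fun i => multiGain L (h d) (lam d i))
          (fun i => Real.sqrt (multiVar L (h d) (lam d i))) p)|
        ∂((stdGauss d).prod (stdGauss d))) atTop (𝓝 0) := by
  have hD0 : 0 ≤ D := by simpa using hD 0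
  rw [Metric.tendsto_atTop']
  intro ε hε
  set c := 2 * ((1 + (1 + (L : ℝ))) * D) with hc
  have hc0 : 0 ≤ c := by positivity
  set R := Real.sqrt (4 * (c + 1) / ε) with hR
  have hR2 : R ^ 2 = 4 * (c + 1) / ε := Real.sq_sqrt (by positivity)
  have hR0 : 0 < R := Real.sqrt_pos.mpr (by positivity)
  obtain ⟨K, hK⟩ := hδ R
  have hsmall : c / R ^ 2 < ε / 2 := by
    rw [hR2, div_lt_iff₀ (by positivity)]
    field_simp
    linarith
  have hlim : Tendsto (fun d => K * Real.sqrt (2 * ((((L : ℝ) ^ 2 / 4 + L) * η d) * D')))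
      atTop (𝓝 0) := by
    have := ((((hη.const_mul ((L : ℝ) ^ 2 / 4 + L)).mul_const D').const_mul 2).sqrt).const_mul K
    simpa using this
  have hall : ∀ᶠ d in atTop, ∫ p, min 1 |φ d (statePoint (Q d) (m d) (fun i => (lam d i)⁻¹) p.1) -
        φ d (propPoint (Q d) (m d) (fun i => (lam d i)⁻¹) (fun i => multiGain L (h d) (lam d i))
          (fun i => Real.sqrt (multiVar L (h d) (lam d i))) p)|
        ∂((stdGauss d).prod (stdGauss d)) < ε := by
    filter_upwards [hev, hLip, hlim.eventually_lt_const (half_pos hε)] with d hd hLd hKd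
    have hb := fun i => multiGain_multiVar_bounds hL hd.1 (hlam d i) (hd.2.2 i) hd.2.1
    have := integral_min_one_abs_potential_le (hQ d) (hlam d) (m d) hR0
      (θ := 1 + L) (θ' := ((L : ℝ) ^ 2 / 4 + L) * η d) (by positivity)
      (mul_nonneg (by positivity) (hη0 d)) (hD d) (hD' d) hδ0 hK hLd (w := fun i => (lam d i)⁻¹)
      (g := fun i => multiGain L (h d) (lam d i))
      (z := fun i => Real.sqrt (multiVar L (h d) (lam d i))) (fun i => rfl)
      (fun i => (hb i).1) (fun i => (hb i).2)
    linarith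
  obtain ⟨N, hN⟩ := eventually_atTop.mp hall
  refine ⟨N, fun d hd => ?_⟩
  rw [Real.dist_eq, sub_zero, abs_of_nonneg (integral_nonneg fun p =>
    le_min zero_le_one (abs_nonneg _))]
  exact hN d hd.le

/-- In equilibrium, the acceptance probability, possibly weighted by a function of one noise
coordinate, converges to `2 Φ(-σ / 2)`. -/
lemma eventually_abs_integral_weight_sub_le (hL : 0 < L) (hη : Tendsto η atTop (𝓝 0))
    (hev : ∀ᶠ d in atTop, 0 < h d ∧ η d ≤ 1 ∧ ∀ i, h d * lam d i ^ 2 ≤ η d)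
    (hη0 : ∀ d, 0 ≤ η d) (hQ : ∀ d, (Q d)ᵀ * Q d = 1) (hlam : ∀ d i, 0 < lam d i)
    (hφ : ∀ d, Measurable (φ d))
    (hB : Tendsto (fun d => h d ^ 3 * ∑ i, lam d i ^ 6) atTop (𝓝 B))
    {σ : ℝ} (hσ : 0 ≤ σ) (hσB : σ ^ 2 = L / 16 * B) {s s' D D' : ℝ}
    (hD : ∀ d, ∑ i, lam d i ^ (4 * s - 2) ≤ D) (hD' : ∀ d, ∑ i, lam d i ^ (4 * s' - 2) ≤ D')
    {δf : ℝ → ℝ → ℝ} (hδ0 : ∀ a b, 0 ≤ δf a b)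
    (hδ : ∀ R : ℝ, ∃ K : ℝ, ∀ a b, |a| ≤ R → |b| ≤ R → δf a b ≤ K)
    (hLip : ∀ᶠ d in atTop, ∀ x y, |φ d x - φ d y| ≤
      δf (anorm (Q d) (fun i => lam d i ^ 2) s (x - m d))
        (anorm (Q d) (fun i => lam d i ^ 2) s (y - m d)) *
          anorm (Q d) (fun i => lam d i ^ 2) s' (x - y))
    {ψ : ℝ → ℝ} (hψ0 : ∀ t, 0 ≤ ψ t) (hψm : Measurable ψ) (hψ : MemLp ψ 2 (gaussianReal 0 1))
    (hψ1 : ∫ t, ψ t ∂(gaussianReal 0 1) = 1) {f : (d : ℕ) → (Fin d → ℝ) → ℝ}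
    (hfm : ∀ d, Measurable (f d)) (hf0 : ∀ d ξ, 0 ≤ f d ξ) {M : ℝ}
    (hfM : ∀ᶠ d in atTop, ∀ ξ, f d ξ ≤ M) (hf1 : ∀ᶠ d in atTop, ∫ ξ, f d ξ ∂(stdGauss d) = 1)
    {ε : ℝ} (hε : 0 < ε) :
    ∀ᶠ d in atTop, ∀ i : Fin d,
      |∫ p, f d p.1 * (ψ (p.2 i) * min 1 (Real.exp (logRatioCoord (φ d) (Q d) (m d)
          (fun i => (lam d i)⁻¹) (fun i => multiGain L (h d) (lam d i))
          (fun i => Real.sqrt (multiVar L (h d) (lam d i))) p)))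
          ∂((stdGauss d).prod (stdGauss d)) - 2 * stdNormalCDF (-(σ / 2))| ≤ ε := by
  have h1 := tendsto_potential_error hL hη hev hη0 hQ hlam hD hD' hδ0 hδ hLip
  have h2 := tendsto_gaussPart_error hL hη hev hB hσB
  have h3 := tendsto_sqrt_error hL hη hev hB hσ hσB
  set K := ∫ t, (ψ t + 1) * |t| ∂(gaussianReal 0 1) with hK
  have hK0 : 0 ≤ K := integral_nonneg fun t => mul_nonneg (by linarith [hψ0 t]) (abs_nonneg _)
  have h4 : Tendsto (fun d => Real.sqrt ((L : ℝ) / 16 * η d ^ 3)) atTop (𝓝 0) := by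
    have := ((hη.pow 3).const_mul ((L : ℝ) / 16)).sqrt
    simpa using this
  have hlim := (((h1.add h2).sqrt.const_mul
    (Real.sqrt (∫ t, ψ t ^ 2 ∂(gaussianReal 0 1)))).const_mul M).add
      (((h4.mul_const K).add h3).const_mul M)
  simp only [add_zero, Real.sqrt_zero, mul_zero, zero_mul] at hlim
  filter_upwards [hev, hfM, hf1, hlim.eventually_le_const hε] with d hd hMd h1d hεd i
  refine le_trans ?_ hεd
  have hM : 0 ≤ M := (hf0 d 0).trans (hMd 0)
  have hZm := measurable_logRatioCoord (hφ d) (Q d) (m d) (fun i => (lam d i)⁻¹)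
    (fun i => multiGain L (h d) (lam d i)) (fun i => Real.sqrt (multiVar L (h d) (lam d i)))
  refine (abs_integral_weight_mul_min_one_exp_sub_le hψ0 hψm hψ hψ1 (hfm d) (hf0 d) hMd h1d hσ
    hZm (fun j => crossCoeff L (h d) (lam d j)) i).trans ?_
  gcongr M * (_ * Real.sqrt ?_) + M * (?_ * _ + _)
  · set G : (Fin d → ℝ) × (Fin d → ℝ) → ℝ := fun p => gaussPart L (h d) (lam d) p -
        (-(σ ^ 2 / 2) + ∑ i, crossCoeff L (h d) (lam d i) * p.1 i * p.2 i) with hG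
    have hGi : Integrable (fun p => |G p|) ((stdGauss d).prod (stdGauss d)) := by
      have e : G = fun p => ∑ i, stateCoeff L (h d) (lam d i) * p.1 i ^ 2 -
          ∑ i, noiseCoeff L (h d) (lam d i) * p.2 i ^ 2 + σ ^ 2 / 2 := by
        ext p; simp only [hG, gaussPart]; ring
      rw [e]
      exact ((((integrable_sq_coord _).comp_fst _).sub ((integrable_sq_coord _).comp_snd _)).add
        (integrable_const _)).abs
    have hφm : Measurable fun p =>
        min 1 |φ d (statePoint (Q d) (m d) (fun i => (lam d i)⁻¹) p.1) -
        φ d (propPoint (Q d) (m d) (fun i => (lam d i)⁻¹) (fun i => multiGain L (h d) (lam d i))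
          (fun i => Real.sqrt (multiVar L (h d) (lam d i))) p)| := by
      have m1 : Measurable fun p : (Fin d → ℝ) × (Fin d → ℝ) =>
          φ d (statePoint (Q d) (m d) (fun i => (lam d i)⁻¹) p.1) :=
        (hφ d).comp ((measurable_statePoint _ _ _).comp measurable_fst)
      have m2 := (hφ d).comp (measurable_propPoint (Q d) (m d) (fun i => (lam d i)⁻¹)
        (fun i => multiGain L (h d) (lam d i)) (fun i => Real.sqrt (multiVar L (h d) (lam d i))))
      exact measurable_const.min (m1.sub m2).abs
    have hφi := integrable_of_bounded (μ := (stdGauss d).prod (stdGauss d)) hφm (M := 1)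
      fun p => by
        rw [abs_of_nonneg (le_min zero_le_one (abs_nonneg _))]; exact min_le_left _ _
    rw [← integral_add hφi hGi]
    refine integral_mono_of_nonneg (Eventually.of_forall fun p =>
      le_min zero_le_one (abs_nonneg _)) (hφi.add hGi) (Eventually.of_forall fun p => ?_)
    simp only [logRatioCoord_eq hL hd.1 (hlam d)]
    rw [add_sub_assoc]
    have hmin : ∀ u v : ℝ, min 1 |u + v| ≤ min 1 |u| + |v| := fun u v => by
      rcases min_cases 1 |u| with ⟨e, -⟩ | ⟨e, -⟩ <;> rw [e]
      · exact (min_le_left _ _).trans (by linarith [abs_nonneg v])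
      · exact (min_le_right _ _).trans (abs_add_le _ _)
    exact hmin _ _
  · refine Real.abs_le_sqrt ((crossCoeff_sq_le hL hd.1 ((hd.2.2 i).trans hd.2.1)).trans ?_)
    gcongr
    exact pow_three_mul_le hd.1 (hd.2.2 i)

end Limits

section LangevinMatrices

variable {d : ℕ} {Q A : Matrix (Fin d) (Fin d) ℝ} {lam : Fin d → ℝ} {h : ℝ}

lemma one_sub_smul_eq_spectralMatrix (hQ : Qᵀ * Q = 1)
    (hA : A = spectralMatrix Q fun i => lam i ^ 2) :
    1 - (h / 2) • A = spectralMatrix Q fun i => 1 - h / 2 * lam i ^ 2 := by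
  rw [hA, ← spectralMatrix_one hQ, spectralMatrix_smul, spectralMatrix_sub]
  rfl

lemma pow_one_sub_smul_eq_spectralMatrix (hQ : Qᵀ * Q = 1)
    (hA : A = spectralMatrix Q fun i => lam i ^ 2) (L : ℕ) :
    (1 - (h / 2) • A) ^ L = spectralMatrix Q fun i => multiGain L h (lam i) := by
  rw [one_sub_smul_eq_spectralMatrix hQ hA, spectralMatrix_pow hQ]
  rfl

lemma noise_eq_spectralMatrix (hQ : Qᵀ * Q = 1) (hA : A = spectralMatrix Q fun i => lam i ^ 2)
    (L : ℕ) :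
    ∑ j ∈ Finset.range L, (1 - (h / 2) • A) ^ j * (h • (1 : Matrix (Fin d) (Fin d) ℝ)) *
        ((1 - (h / 2) • A)ᵀ) ^ j =
      spectralMatrix Q fun i => multiVar L h (lam i) := by
  have hT : (1 - (h / 2) • A)ᵀ = 1 - (h / 2) • A := by
    rw [one_sub_smul_eq_spectralMatrix hQ hA, spectralMatrix_transpose]
  simp only [hT, pow_one_sub_smul_eq_spectralMatrix hQ hA, Matrix.mul_smul,
    Matrix.mul_one, spectralMatrix_mul hQ, spectralMatrix_smul, spectralMatrix_sum]
  congr 1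
  ext i
  simp [multiVar, multiGain, Finset.mul_sum, pow_two]

lemma inv_noise_eq_spectralMatrix (hQ : Qᵀ * Q = 1) (hA : A = spectralMatrix Q fun i => lam i ^ 2)
    {L : ℕ} (hL : 0 < L) (hh : 0 < h) :
    (∑ j ∈ Finset.range L, (1 - (h / 2) • A) ^ j * (h • (1 : Matrix (Fin d) (Fin d) ℝ)) *
        ((1 - (h / 2) • A)ᵀ) ^ j)⁻¹ =
      spectralMatrix Q fun i => (Real.sqrt (multiVar L h (lam i)) ^ 2)⁻¹ := by
  have hv : ∀ i, 0 < multiVar L h (lam i) := fun i => multiVar_pos hL hh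
  rw [noise_eq_spectralMatrix hQ hA, spectralMatrix_inv hQ fun i => (hv i).ne']
  congr 1
  ext i
  rw [Real.sq_sqrt (hv i).le, Pi.inv_apply]

lemma offset_eq (hQ : Qᵀ * Q = 1) (hA : A = spectralMatrix Q fun i => lam i ^ 2)
    (hlam : ∀ i, 0 < lam i) (hh : 0 < h) (L : ℕ) (b : Fin d → ℝ) :
    ((1 - (1 - (h / 2) • A))⁻¹ * (1 - (1 - (h / 2) • A) ^ L)) *ᵥ ((h / 2) • b) =
      A⁻¹ *ᵥ b - spectralMatrix Q (fun i => multiGain L h (lam i)) *ᵥ (A⁻¹ *ᵥ b) := by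
  have hl : ∀ i, lam i ^ 2 ≠ 0 := fun i => (pow_pos (hlam i) 2).ne'
  have hA' : A⁻¹ = spectralMatrix Q (fun i => lam i ^ 2)⁻¹ := by rw [hA, spectralMatrix_inv hQ hl]
  have hhA : ((h / 2) • A)⁻¹ = spectralMatrix Q ((h / 2) • fun i => lam i ^ 2)⁻¹ := by
    rw [hA, spectralMatrix_smul, spectralMatrix_inv hQ]
    intro i
    exact mul_ne_zero (by positivity) (hl i)
  rw [pow_one_sub_smul_eq_spectralMatrix hQ hA, sub_sub_cancel, hhA, hA', Matrix.mulVec_smul,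
    ← Matrix.smul_mulVec, Matrix.mulVec_mulVec, ← Matrix.sub_mulVec, ← spectralMatrix_one hQ]
  simp only [spectralMatrix_mul hQ, spectralMatrix_smul, spectralMatrix_sub]
  congr 2
  ext i
  have := hl i
  simp only [Pi.smul_apply, Pi.mul_apply, Pi.inv_apply, Pi.sub_apply, Pi.one_apply, smul_eq_mul]
  field_simp

lemma precision_eq_spectralMatrix (hA : A = spectralMatrix Q fun i => lam i ^ 2) :
    A = spectralMatrix Q fun i => ((lam i)⁻¹ ^ 2)⁻¹ := by
  simp [hA]

end LangevinMatrices

section Expectations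

variable {d : ℕ} {Q : Matrix (Fin d) (Fin d) ℝ}

lemma expAccept_eq (hQ : Qᵀ * Q = 1) {φ : (Fin d → ℝ) → ℝ} (hφ : Measurable φ)
    (m : Fin d → ℝ) {w g z : Fin d → ℝ} (hw : ∀ i, 0 < w i) (hz : ∀ i, 0 < z i)
    {S : Matrix (Fin d) (Fin d) ℝ} (hS : S⁻¹ = spectralMatrix Q fun i => (z i ^ 2)⁻¹)
    {gv : Fin d → ℝ} (hgv : gv = m - spectralMatrix Q g *ᵥ m)
    (hZ : 0 < ∫ ξ, Real.exp (-(φ (statePoint Q m w ξ))) ∂(stdGauss d)) :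
    expAccept (ngDensity φ m (spectralMatrix Q fun i => (w i ^ 2)⁻¹))
        (propDensity (spectralMatrix Q g) gv S) =
      ∫ p, weight φ Q m w p.1 * min 1 (Real.exp (logRatioCoord φ Q m w g z p))
        ∂((stdGauss d).prod (stdGauss d)) := by
  have hm := measurable_accept
    (measurable_ngDensity hφ m (spectralMatrix Q fun i => (w i ^ 2)⁻¹))
    (measurable_propDensity (spectralMatrix Q g) gv S)
  rw [expAccept, integral_jointMeasure hQ hφ m hw hz hS hgv hm]
  rw [← integral_exp_mul_gaussDensity hQ hφ m hw] at hZ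
  simp only [accept_coord hQ m hw hz hS hgv hZ]

lemma expSqJump_eq (hQ : Qᵀ * Q = 1) {φ : (Fin d → ℝ) → ℝ} (hφ : Measurable φ)
    (m : Fin d → ℝ) {w g z : Fin d → ℝ} (hw : ∀ i, 0 < w i) (hz : ∀ i, 0 < z i)
    {S : Matrix (Fin d) (Fin d) ℝ} (hS : S⁻¹ = spectralMatrix Q fun i => (z i ^ 2)⁻¹)
    {gv : Fin d → ℝ} (hgv : gv = m - spectralMatrix Q g *ᵥ m)
    (hZ : 0 < ∫ ξ, Real.exp (-(φ (statePoint Q m w ξ))) ∂(stdGauss d)) (i : Fin d) :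
    expSqJump (ngDensity φ m (spectralMatrix Q fun i => (w i ^ 2)⁻¹))
        (propDensity (spectralMatrix Q g) gv S) (fun k => Q k i) =
      ∫ p, weight φ Q m w p.1 * ((z i * p.2 i - (1 - g i) * w i * p.1 i) ^ 2 *
        min 1 (Real.exp (logRatioCoord φ Q m w g z p))) ∂((stdGauss d).prod (stdGauss d)) := by
  have hm := measurable_accept
    (measurable_ngDensity hφ m (spectralMatrix Q fun i => (w i ^ 2)⁻¹))
    (measurable_propDensity (spectralMatrix Q g) gv S)
  have hl : Measurable fun p : (Fin d → ℝ) × (Fin d → ℝ) =>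
      ((fun k => Q k i) ⬝ᵥ (p.2 - p.1)) ^ 2 := by
    unfold dotProduct
    fun_prop
  refine (integral_jointMeasure hQ hφ m hw hz hS hgv (hl.mul hm)).trans ?_
  rw [← integral_exp_mul_gaussDensity hQ hφ m hw] at hZ
  simp only [Pi.mul_apply, accept_coord hQ m hw hz hS hgv hZ, col_dotProduct_sub hQ, mul_assoc]

end Expectations

section Jump

lemma abs_integral_jump_sub_le {d L : ℕ} {h x η P ε : ℝ} (hL : 0 < L) (hh : 0 < h) (hx0 : 0 < x)
    (hx : h * x ^ 2 ≤ η) (hη : η ≤ 1) (hP0 : 0 ≤ P) (hP1 : P ≤ 1)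
    {f : (Fin d → ℝ) → ℝ} (hfm : Measurable f) (hf0 : ∀ ξ, 0 ≤ f ξ) {M : ℝ} (hfM : ∀ ξ, f ξ ≤ M)
    {α : (Fin d → ℝ) × (Fin d → ℝ) → ℝ} (hα : Measurable α) (hα0 : ∀ p, 0 ≤ α p)
    (hα1 : ∀ p, α p ≤ 1) (i : Fin d)
    (hlim : |∫ p, f p.1 * (p.2 i ^ 2 * α p) ∂((stdGauss d).prod (stdGauss d)) - 2 * P| ≤ ε) :
    |∫ p, f p.1 * ((Real.sqrt (multiVar L h x) * p.2 i -
        (1 - multiGain L h x) * x⁻¹ * p.1 i) ^ 2 * α p) ∂((stdGauss d).prod (stdGauss d)) -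
        2 * L * h * P| ≤
      h * (L * ε + 2 * L ^ 2 * η + M * (L * Real.sqrt (L * η) + L ^ 2 * η / 4)) := by
  have hx1 := hx.trans hη
  have hM : 0 ≤ M := (hf0 0).trans (hfM 0)
  have hη0 : 0 ≤ η := (mul_nonneg hh.le (sq_nonneg x)).trans hx
  have hL0 : (0 : ℝ) ≤ L := Nat.cast_nonneg L
  have hg1 := multiGain_le_one (L := L) hh hx1
  have hg0 := multiGain_nonneg (L := L) hx1
  have hS := multiVar_le (L := L) hh hx1
  have hS0 := (multiVar_pos (x := x) hL hh).le
  have hSg := mul_multiGain_sq_le_multiVar (L := L) hh hx1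
  have hgg := one_sub_le_multiGain_sq (L := L) hx1
  have hg := one_sub_multiGain_le (L := L) hx1
  set S := multiVar L h x with hSdef
  set g := multiGain L h x with hgdef
  have hu0 := Real.sqrt_nonneg S
  have hv0 : 0 ≤ (1 - g) * x⁻¹ := mul_nonneg (by linarith) (by positivity)
  have hv : (1 - g) * x⁻¹ ≤ L * h * x / 2 := by
    rw [← div_eq_mul_inv, div_le_iff₀ hx0]; linarith
  have hjump := abs_integral_weight_sq_sub_le hfm hf0 hfM hα hα0 hα1 hu0 hv0 i
  rw [Real.sq_sqrt hS0] at hjump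
  set J := ∫ p, f p.1 * ((Real.sqrt S * p.2 i - (1 - g) * x⁻¹ * p.1 i) ^ 2 * α p)
    ∂((stdGauss d).prod (stdGauss d)) with hJ
  set I := ∫ p, f p.1 * (p.2 i ^ 2 * α p) ∂((stdGauss d).prod (stdGauss d)) with hI
  have hε : 0 ≤ ε := (abs_nonneg _).trans hlim
  have hdrift : ((1 - g) * x⁻¹) ^ 2 ≤ h * (L ^ 2 * η / 4) :=
    calc ((1 - g) * x⁻¹) ^ 2 ≤ (L * h * x / 2) ^ 2 := pow_le_pow_left₀ hv0 hv 2
      _ = h * (L ^ 2 * (h * x ^ 2) / 4) := by ring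
      _ ≤ _ := by gcongr
  have hcross : 2 * Real.sqrt S * ((1 - g) * x⁻¹) ≤ h * (L * Real.sqrt (L * η)) := by
    have h1 : Real.sqrt S * x ≤ Real.sqrt (L * η) := by
      refine Real.le_sqrt_of_sq_le ?_
      rw [mul_pow, Real.sq_sqrt hS0]
      calc S * x ^ 2 ≤ h * L * x ^ 2 := by gcongr
        _ = L * (h * x ^ 2) := by ring
        _ ≤ _ := by gcongr
    calc 2 * Real.sqrt S * ((1 - g) * x⁻¹) ≤ 2 * Real.sqrt S * (L * h * x / 2) := by gcongr
      _ = h * (L * (Real.sqrt S * x)) := by ring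
      _ ≤ _ := by gcongr
  have hmain : |S * I - S * (2 * P)| ≤ h * (L * ε) := by
    rw [← mul_sub, abs_mul, abs_of_nonneg hS0, ← mul_assoc]
    exact mul_le_mul hS hlim (abs_nonneg _) (by positivity)
  have hvar : |S * (2 * P) - 2 * L * h * P| ≤ h * (2 * L ^ 2 * η) := by
    have h1 : S * (2 * P) - 2 * L * h * P = -((h * L - S) * (2 * P)) := by ring
    have h2 : h * L - S ≤ h * L * (L * η) := by
      have : h * L * (1 - L * η) ≤ h * L * g ^ 2 := by
        gcongr
        exact le_trans (by gcongr) hgg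
      linarith
    rw [h1, abs_neg, abs_of_nonneg (mul_nonneg (by linarith) (by linarith))]
    calc (h * L - S) * (2 * P) ≤ h * L * (L * η) * (2 * 1) := by
          refine mul_le_mul h2 (by linarith) (by linarith) (by positivity)
      _ = _ := by ring
  have hrest : M * (2 * Real.sqrt S * ((1 - g) * x⁻¹) + ((1 - g) * x⁻¹) ^ 2) ≤
      h * (M * (L * Real.sqrt (L * η) + L ^ 2 * η / 4)) := by
    have := mul_le_mul_of_nonneg_left (add_le_add hcross hdrift) hM
    linarith
  have h3 := abs_add_three (J - S * I) (S * I - S * (2 * P)) (S * (2 * P) - 2 * L * h * P)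
  have h4 : J - S * I + (S * I - S * (2 * P)) + (S * (2 * P) - 2 * L * h * P) =
    J - 2 * L * h * P := by ring
  rw [h4] at h3
  linarith

end Jump

section Scaling

lemma exists_sum_rpow_le {lam : (d : ℕ) → Fin d → ℝ} {c r S s : ℝ} (hc : 0 < c)
    (hlam : ∀ d i, c ≤ lam d i)
    (h : Tendsto (fun d : ℕ => ∑ i, lam d i ^ (4 * r - 2)) atTop (𝓝 S)) (hs : s ≤ r) :
    ∃ D, 0 ≤ D ∧ ∀ d, ∑ i, lam d i ^ (4 * s - 2) ≤ D := by
  obtain ⟨K, hK⟩ := h.bddAbove_range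
  have hK' : ∀ d, ∑ i, lam d i ^ (4 * r - 2) ≤ K := fun d => hK ⟨d, rfl⟩
  refine ⟨c ^ (4 * (s - r)) * K, mul_nonneg (by positivity) (by simpa using hK' 0), fun d => ?_⟩
  refine le_trans ?_ (mul_le_mul_of_nonneg_left (hK' d) (by positivity))
  rw [Finset.mul_sum]
  refine Finset.sum_le_sum fun i _ => ?_
  have hpos := hc.trans_le (hlam d i)
  have : 4 * s - 2 = 4 * (s - r) + (4 * r - 2) := by ring
  rw [this, Real.rpow_add hpos]
  exact mul_le_mul_of_nonneg_right
    (Real.rpow_le_rpow_of_nonpos hc (hlam d i) (by linarith)) (by positivity)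

lemma step_pos {l κ : ℝ} (hl : 0 < l) {d : ℕ} (hd : 0 < d) :
    0 < l ^ 2 * (d : ℝ) ^ (-(1 / 3 : ℝ) - 2 * κ) := by
  have : (0 : ℝ) < d := Nat.cast_pos.mpr hd
  positivity

lemma step_mul_sq_le {l κ C x : ℝ} (hκ : 0 ≤ κ) (hC : 0 < C) {d : ℕ} (i : Fin d)
    (hx0 : 0 < x) (hx : x ≤ C * (((i : ℕ) + 1 : ℝ)) ^ κ) :
    l ^ 2 * (d : ℝ) ^ (-(1 / 3 : ℝ) - 2 * κ) * x ^ 2 ≤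
      C ^ 2 * l ^ 2 * (d : ℝ) ^ (-(1 / 3 : ℝ)) := by
  have hd : (0 : ℝ) < d := Nat.cast_pos.mpr i.pos
  have hi : ((i : ℕ) + 1 : ℝ) ≤ d := by exact_mod_cast i.isLt
  have hx' : x ≤ C * (d : ℝ) ^ κ :=
    hx.trans (mul_le_mul_of_nonneg_left (Real.rpow_le_rpow (by positivity) hi hκ) hC.le)
  have h1 : (d : ℝ) ^ (-(1 / 3 : ℝ) - 2 * κ) * ((d : ℝ) ^ κ) ^ 2 = (d : ℝ) ^ (-(1 / 3 : ℝ)) := by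
    rw [← Real.rpow_natCast, ← Real.rpow_mul hd.le, ← Real.rpow_add hd]
    congr 1
    push_cast
    ring
  calc l ^ 2 * (d : ℝ) ^ (-(1 / 3 : ℝ) - 2 * κ) * x ^ 2
      ≤ l ^ 2 * (d : ℝ) ^ (-(1 / 3 : ℝ) - 2 * κ) * (C * (d : ℝ) ^ κ) ^ 2 := by gcongr
    _ = C ^ 2 * l ^ 2 * ((d : ℝ) ^ (-(1 / 3 : ℝ) - 2 * κ) * ((d : ℝ) ^ κ) ^ 2) := by ring
    _ = _ := by rw [h1]

lemma tendsto_const_mul_rpow_neg (a : ℝ) :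
    Tendsto (fun d : ℕ => a * (d : ℝ) ^ (-(1 / 3 : ℝ))) atTop (𝓝 0) := by
  simpa using ((tendsto_rpow_neg_atTop (by norm_num : (0 : ℝ) < 1 / 3)).comp
    tendsto_natCast_atTop_atTop).const_mul a

lemma tendsto_step_pow_three_mul {l κ τ : ℝ} {S : ℕ → ℝ}
    (h : Tendsto (fun d : ℕ => (d : ℝ) ^ (-(1 + 6 * κ)) * S d) atTop (𝓝 τ)) :
    Tendsto (fun d : ℕ => (l ^ 2 * (d : ℝ) ^ (-(1 / 3 : ℝ) - 2 * κ)) ^ 3 * S d) atTop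
      (𝓝 (l ^ 6 * τ)) := by
  refine (h.const_mul (l ^ 6)).congr fun d => ?_
  have h1 : ((d : ℝ) ^ (-(1 / 3 : ℝ) - 2 * κ)) ^ 3 = (d : ℝ) ^ (-(1 + 6 * κ)) := by
    rw [← Real.rpow_natCast, ← Real.rpow_mul (Nat.cast_nonneg d)]
    congr 1
    push_cast
    ring
  rw [mul_pow, h1]
  ring

lemma stdNormalCDF_nonneg (z : ℝ) : 0 ≤ stdNormalCDF z := ENNReal.toReal_nonneg

lemma stdNormalCDF_le_one (z : ℝ) : stdNormalCDF z ≤ 1 :=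
  ENNReal.toReal_le_of_le_ofReal zero_le_one (by simpa using prob_le_one)

end Scaling

end AR1

namespace AR1

/-- Multi-step SLA: the proposal takes `L` steps of
`y⁽ˡ⁾ = (I−(h/2)A)y⁽ˡ⁻¹⁾ + (h/2)b + ν⁽ˡ⁾`, `ν⁽ˡ⁾ ~ N(0,hI)`, from `y⁽⁰⁾ = x`.  If the
eigenvalues of `A` grow like `i^κ`, `φ_d` satisfies the regularity assumptions, and
`h = l²d^{−1/3−2κ}`, then in equilibrium `E[α(x,y)] → 2Φ(−l³√(Lτ)/8)` and
`E[(xᵢ'−xᵢ)²] = 2LhΦ(−l³√(Lτ)/8) + o(h)`. -/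
theorem stmt_17
    (A Q : (d : ℕ) → Matrix (Fin d) (Fin d) ℝ)
    (b : (d : ℕ) → Fin d → ℝ)
    (lam : (d : ℕ) → Fin d → ℝ)
    (hQ : ∀ d, (Q d)ᵀ * Q d = 1)
    (hAdiag : ∀ d, A d = Q d * Matrix.diagonal (fun i => lam d i ^ 2) * (Q d)ᵀ)
    (hlampos : ∀ d i, 0 < lam d i)
    (L : ℕ) (hL : 0 < L)
    (φ : (d : ℕ) → (Fin d → ℝ) → ℝ) (hφmeas : ∀ d, Measurable (φ d))
    -- eigenvalue growth `c·i^κ ≤ λᵢ ≤ C·i^κ`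
    (c C κ0 : ℝ) (hc : 0 < c) (hC : 0 < C) (hκ0 : 0 ≤ κ0)
    (hgrow : ∀ d, ∀ i : Fin d,
      c * (((i : ℕ) + 1 : ℝ)) ^ κ0 ≤ lam d i ∧ lam d i ≤ C * (((i : ℕ) + 1 : ℝ)) ^ κ0)
    -- Assumption 1 on `φ_d`, with norms `|x|_s = |A^s x|`
    (m0 s s' s'' Cphi pexp : ℝ) (hCphi : 0 < Cphi) (hpexp : 0 < pexp)
    (δf : ℝ → ℝ → ℝ) (hδf0 : ∀ a b', 0 ≤ δf a b')
    (hδfloc : ∀ R : ℝ, ∃ K : ℝ, ∀ a b', |a| ≤ R → |b'| ≤ R → δf a b' ≤ K)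
    (hAss1 : ∀ᶠ d : ℕ in atTop, ∀ x y : Fin d → ℝ,
      m0 ≤ φ d x ∧
      |φ d x - φ d y| ≤
        δf (anorm (Q d) (fun i => lam d i ^ 2) s (x - (A d)⁻¹ *ᵥ b d))
           (anorm (Q d) (fun i => lam d i ^ 2) s (y - (A d)⁻¹ *ᵥ b d)) *
          anorm (Q d) (fun i => lam d i ^ 2) s' (x - y) ∧
      |φ d x| ≤ Cphi *
        (1 + anorm (Q d) (fun i => lam d i ^ 2) s'' (x - (A d)⁻¹ *ᵥ b d) ^ pexp))
    -- Assumption 2 with `r = max{s, s', s''}`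
    (Sr : ℝ)
    (hAss2 : Tendsto (fun d : ℕ => ∑ i,
        lam d i ^ (4 * max s (max s' s'') - 2)) atTop (𝓝 Sr))
    -- the step size `h = l² d^{−1/3−2κ}` and the limit `τ`
    (l : ℝ) (hl : 0 < l)
    (hstep : ℕ → ℝ)
    (hhstep : ∀ d : ℕ, hstep d = l ^ 2 * (d : ℝ) ^ (-(1 / 3 : ℝ) - 2 * κ0))
    (τ : ℝ)
    (hτ : Tendsto (fun d : ℕ =>
        (d : ℝ) ^ (-(1 + 6 * κ0)) * ∑ i, lam d i ^ 6) atTop (𝓝 τ))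
    -- the `L`-step SLA proposal: iteration matrix `G_L = G^L`, `G = I − (h/2)A`,
    -- offset `g_L = (I−G)⁻¹(I−G^L)(h/2)b`, noise covariance `Σ_L = ∑_{j<L} Gʲ(hI)(Gᵀ)ʲ`
    (Gp Sp : (d : ℕ) → Matrix (Fin d) (Fin d) ℝ) (gp : (d : ℕ) → Fin d → ℝ)
    (hGp : ∀ d, Gp d = (1 - (hstep d / 2) • A d) ^ L)
    (hgp : ∀ d, gp d = ((1 - (1 - (hstep d / 2) • A d))⁻¹ *
      (1 - (1 - (hstep d / 2) • A d) ^ L)) *ᵥ ((hstep d / 2) • b d))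
    (hSp : ∀ d, Sp d = ∑ j ∈ Finset.range L,
      (1 - (hstep d / 2) • A d) ^ j * (hstep d • (1 : Matrix (Fin d) (Fin d) ℝ)) *
        ((1 - (hstep d / 2) • A d)ᵀ) ^ j) :
    Tendsto (fun d : ℕ => expAccept (ngDensity (φ d) ((A d)⁻¹ *ᵥ b d) (A d))
        (propDensity (Gp d) (gp d) (Sp d)))
      atTop (𝓝 (2 * stdNormalCDF (-(l ^ 3 * Real.sqrt (L * τ) / 8)))) ∧
    ∃ e : (d : ℕ) → Fin d → ℝ,
      (∀ d i, expSqJump (ngDensity (φ d) ((A d)⁻¹ *ᵥ b d) (A d))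
          (propDensity (Gp d) (gp d) (Sp d)) (fun k => Q d k i) =
        2 * L * hstep d * stdNormalCDF (-(l ^ 3 * Real.sqrt (L * τ) / 8)) + e d i) ∧
      (∀ ε > 0, ∀ᶠ d : ℕ in atTop, ∀ i, |e d i| ≤ ε * hstep d) := by
  have hd0 : ∀ᶠ d : ℕ in atTop, 0 < d := eventually_gt_atTop 0
  set m : (d : ℕ) → Fin d → ℝ := fun d => (A d)⁻¹ *ᵥ b d with hm
  set η : ℕ → ℝ := fun d => C ^ 2 * l ^ 2 * (d : ℝ) ^ (-(1 / 3 : ℝ)) with hηdef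
  set w : (d : ℕ) → Fin d → ℝ := fun d i => (lam d i)⁻¹ with hwdef
  set g : (d : ℕ) → Fin d → ℝ := fun d i => multiGain L (hstep d) (lam d i) with hgdef
  set z : (d : ℕ) → Fin d → ℝ := fun d i => Real.sqrt (multiVar L (hstep d) (lam d i)) with hzdef
  have hη : Tendsto η atTop (𝓝 0) := tendsto_const_mul_rpow_neg _
  have hη0 : ∀ d, 0 ≤ η d := fun d => by positivity
  have hhpos : ∀ {d : ℕ}, 0 < d → 0 < hstep d := fun {d} hd => by
    rw [hhstep]; exact step_pos hl hd
  have hhη : ∀ d i, hstep d * lam d i ^ 2 ≤ η d := fun d i => by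
    rw [hhstep]; exact step_mul_sq_le hκ0 hC i (hlampos d i) (hgrow d i).2
  have hev : ∀ᶠ d in atTop, 0 < hstep d ∧ η d ≤ 1 ∧ ∀ i, hstep d * lam d i ^ 2 ≤ η d := by
    filter_upwards [hd0, hη.eventually_le_const zero_lt_one] with d hd h1
    exact ⟨hhpos hd, h1, hhη d⟩
  have hB : Tendsto (fun d => hstep d ^ 3 * ∑ i, lam d i ^ 6) atTop (𝓝 (l ^ 6 * τ)) := by
    simp only [hhstep]
    exact tendsto_step_pow_three_mul hτ
  have hτ0 : 0 ≤ τ := ge_of_tendsto' hτ fun d =>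
    mul_nonneg (by positivity) (Finset.sum_nonneg fun i _ => by positivity)
  have hσ : 0 ≤ l ^ 3 * Real.sqrt (L * τ) / 4 := by positivity
  have hσB : (l ^ 3 * Real.sqrt (L * τ) / 4) ^ 2 = L / 16 * (l ^ 6 * τ) := by
    rw [div_pow, mul_pow, Real.sq_sqrt (by positivity)]; ring
  have hσ2 : l ^ 3 * Real.sqrt (L * τ) / 4 / 2 = l ^ 3 * Real.sqrt (L * τ) / 8 := by ring
  have hclam : ∀ d i, c ≤ lam d i := fun d i => by
    have h1 : (1 : ℝ) ≤ ((i : ℕ) + 1 : ℝ) ^ κ0 :=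
      Real.one_le_rpow (by have := Nat.cast_nonneg (α := ℝ) (i : ℕ); linarith) hκ0
    nlinarith [(hgrow d i).1]
  obtain ⟨D, -, hD⟩ := exists_sum_rpow_le hc hclam hAss2 (le_max_left s (max s' s''))
  obtain ⟨D', -, hD'⟩ := exists_sum_rpow_le hc hclam hAss2
    ((le_max_left s' s'').trans (le_max_right s (max s' s'')))
  obtain ⟨D'', hD''0, hD''⟩ := exists_sum_rpow_le hc hclam hAss2
    ((le_max_right s' s'').trans (le_max_right s (max s' s'')))
  set ζ := Real.exp (-(Cphi * (1 + (2 * Real.sqrt (D'' + 1)) ^ pexp))) / 2 with hζdef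
  have hζ : 0 < ζ := by positivity
  set M := Real.exp (-m0) / ζ with hMdef
  have hM0 : 0 ≤ M := by positivity
  have hZ : ∀ᶠ d in atTop,
      ζ ≤ ∫ ξ, Real.exp (-(φ d (statePoint (Q d) (m d) (w d) ξ))) ∂(stdGauss d) := by
    filter_upwards [hAss1] with d hd
    exact le_integral_exp_neg (hQ d) (hlampos d) (hφmeas d) (m d) hCphi.le hpexp.le hD''0 (hD'' d)
      (fun x => (hd x x).1) (fun x => (hd x x).2.2)
  have hWM : ∀ᶠ d in atTop, ∀ ξ, weight (φ d) (Q d) (m d) (w d) ξ ≤ M := by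
    filter_upwards [hAss1, hZ] with d hd hZd
    exact weight_le hζ (fun x => (hd x x).1) hZd
  have hW1 : ∀ᶠ d in atTop, ∫ ξ, weight (φ d) (Q d) (m d) (w d) ξ ∂(stdGauss d) = 1 :=
    hZ.mono fun d hd => integral_weight (hζ.trans_le hd)
  have hLip : ∀ᶠ d in atTop, ∀ x y, |φ d x - φ d y| ≤
      δf (anorm (Q d) (fun i => lam d i ^ 2) s (x - m d))
        (anorm (Q d) (fun i => lam d i ^ 2) s (y - m d)) *
          anorm (Q d) (fun i => lam d i ^ 2) s' (x - y) :=
    hAss1.mono fun d hd x y => (hd x y).2.1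
  have hcore : ∀ {ψ : ℝ → ℝ}, (∀ t, 0 ≤ ψ t) → Measurable ψ →
      MemLp ψ 2 (ProbabilityTheory.gaussianReal 0 1) →
      ∫ t, ψ t ∂(ProbabilityTheory.gaussianReal 0 1) = 1 → ∀ {ε : ℝ}, 0 < ε →
      ∀ᶠ d in atTop, ∀ i : Fin d,
        |∫ p, weight (φ d) (Q d) (m d) (w d) p.1 * (ψ (p.2 i) *
          min 1 (Real.exp (logRatioCoord (φ d) (Q d) (m d) (w d) (g d) (z d) p)))
          ∂((stdGauss d).prod (stdGauss d)) -
          2 * stdNormalCDF (-(l ^ 3 * Real.sqrt (L * τ) / 8))| ≤ ε := by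
    intro ψ hψ0 hψm hψ hψ1 ε hε
    rw [← hσ2]
    exact eventually_abs_integral_weight_sub_le hL hη hev hη0 hQ hlampos hφmeas hB hσ hσB hD hD'
      hδf0 hδfloc hLip hψ0 hψm hψ hψ1 (fun d => measurable_weight (hφmeas d) (Q d) (m d) (w d))
      (fun d => weight_nonneg (φ d) (Q d) (m d) (w d)) hWM hW1 hε
  have hAs : ∀ d, A d = spectralMatrix (Q d) fun i => lam d i ^ 2 := hAdiag
  have hAw : ∀ d, A d = spectralMatrix (Q d) fun i => (w d i ^ 2)⁻¹ :=
    fun d => precision_eq_spectralMatrix (hAs d)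
  have hGs : ∀ d, Gp d = spectralMatrix (Q d) (g d) := fun d =>
    (hGp d).trans (pow_one_sub_smul_eq_spectralMatrix (hQ d) (hAs d) L)
  have hSs : ∀ {d : ℕ}, 0 < d → (Sp d)⁻¹ = spectralMatrix (Q d) fun i => (z d i ^ 2)⁻¹ :=
    fun {d} hd => by
      rw [hSp]; exact inv_noise_eq_spectralMatrix (hQ d) (hAs d) hL (hhpos hd)
  have hgs : ∀ {d : ℕ}, 0 < d → gp d = m d - spectralMatrix (Q d) (g d) *ᵥ m d := fun {d} hd =>
    (hgp d).trans (offset_eq (hQ d) (hAs d) (hlampos d) (hhpos hd) L (b d))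
  have hw : ∀ d i, 0 < w d i := fun d i => inv_pos.mpr (hlampos d i)
  have hz : ∀ {d : ℕ}, 0 < d → ∀ i, 0 < z d i := fun {d} hd i =>
    Real.sqrt_pos.mpr (multiVar_pos hL (hhpos hd))
  refine ⟨?_, fun d i => expSqJump (ngDensity (φ d) (m d) (A d))
      (propDensity (Gp d) (gp d) (Sp d)) (fun k => Q d k i) -
        2 * L * hstep d * stdNormalCDF (-(l ^ 3 * Real.sqrt (L * τ) / 8)),
      fun d i => by ring, ?_⟩
  · rw [Metric.tendsto_nhds]
    intro ε hε
    filter_upwards [hd0, hZ, hcore (ψ := fun _ => 1) (fun _ => zero_le_one) measurable_const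
      (memLp_const 1) (by simp) (half_pos hε)] with d hd hZd hlim
    have hA := expAccept_eq (hQ d) (hφmeas d) (m d) (hw d) (hz hd) (hSs hd) (hgs hd)
      (hζ.trans_le hZd)
    rw [← hAw, ← hGs] at hA
    rw [hA, Real.dist_eq]
    have := hlim ⟨0, hd⟩
    simp only [one_mul] at this
    linarith
  · intro ε hε
    have hrest : Tendsto (fun d => 2 * (L : ℝ) ^ 2 * η d +
        M * (L * Real.sqrt (L * η d) + L ^ 2 * η d / 4)) atTop (𝓝 0) := by
      have h1 := ((hη.const_mul (L : ℝ)).sqrt).const_mul (L : ℝ)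
      have h2 := (hη.const_mul ((L : ℝ) ^ 2)).div_const 4
      simpa using (hη.const_mul (2 * (L : ℝ) ^ 2)).add ((h1.add h2).const_mul M)
    have hL' : (0 : ℝ) < L := Nat.cast_pos.mpr hL
    filter_upwards [hd0, hev, hZ, hWM, hrest.eventually_le_const (half_pos hε),
      hcore (ψ := fun t => t ^ 2) (fun t => sq_nonneg t) (by fun_prop) memLp_sq_gaussian
        integral_sq_gaussian (ε := ε / (2 * L)) (by positivity)] with d hd hevd hZd hWd hr hlim i
    have hJ := expSqJump_eq (hQ d) (hφmeas d) (m d) (hw d) (hz hd) (hSs hd) (hgs hd)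
      (hζ.trans_le hZd) i
    rw [← hAw, ← hGs] at hJ
    rw [hJ]
    have hαm := measurable_min_one_exp.comp
      (measurable_logRatioCoord (hφmeas d) (Q d) (m d) (w d) (g d) (z d))
    refine (abs_integral_jump_sub_le hL hevd.1 (hlampos d i) (hhη d i) hevd.2.1
      (stdNormalCDF_nonneg _) (stdNormalCDF_le_one _)
      (measurable_weight (hφmeas d) (Q d) (m d) (w d))
      (weight_nonneg (φ d) (Q d) (m d) (w d)) hWd hαm (fun p => min_one_exp_nonneg _)
      (fun p => min_le_left _ _) i (hlim i)).trans ?_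
    rw [mul_comm ε]
    refine mul_le_mul_of_nonneg_left ?_ hevd.1.le
    have : (L : ℝ) * (ε / (2 * L)) = ε / 2 := by field_simp
    linarith

end AR1
end
end

section
/- Let B ∈ ℝ^{d×d} be symmetric positive definite with eigenvalues λ_i², h > 0 with h²λ_i² < 4 for all i, and L ∈ ℕ. Define the 2d×2d leapfrog iteration matrix 𝒦 with d×d blocks 𝒦₁₁ = I − (h²/2)B, 𝒦₁₂ = hI, 𝒦₂₁ = −hB + (h³/4)B², 𝒦₂₂ = I − (h²/2)B. Then the (1,1) block (𝒦^L)₁₁ of 𝒦^L has eigenvalues G_i = cos(Lθ_i), where θ_i = −cos^{-1}(1 − (h²/2)λ_i²). -/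
noncomputable section

open MeasureTheory Matrix Filter Topology

namespace AR1

/-- The powers of a block matrix `[[A, C], [D, A]]` with `C D = D C = A² - 1`, `A` commuting with
`C` and `D`, have leading blocks obeying the Chebyshev recurrence. -/
lemma toBlocks₁₁_fromBlocks_pow_add_two {n R : Type*} [Fintype n] [DecidableEq n] [CommRing R]
    (A C D : Matrix n n R) (hCD : C * D = A * A - 1) (hDC : D * C = A * A - 1)
    (hC : C * A = A * C) (hD : D * A = A * D) (k : ℕ) :
    ((fromBlocks A C D A) ^ (k + 2)).toBlocks₁₁ =
      2 * A * ((fromBlocks A C D A) ^ (k + 1)).toBlocks₁₁ -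
        ((fromBlocks A C D A) ^ k).toBlocks₁₁ := by
  have hsq : fromBlocks A C D A * fromBlocks A C D A =
      fromBlocks (2 * A) 0 0 (2 * A) * fromBlocks A C D A - 1 := by
    rw [← fromBlocks_one, fromBlocks_multiply, fromBlocks_multiply, sub_eq_add_neg,
      fromBlocks_neg, fromBlocks_add, hCD, hDC, hC, hD]
    congr 1 <;> noncomm_ring
  have hpow : fromBlocks A C D A ^ (k + 2) =
      fromBlocks (2 * A) 0 0 (2 * A) * fromBlocks A C D A ^ (k + 1) -
        fromBlocks A C D A ^ k := by
    rw [pow_add, pow_two, ((Commute.refl (fromBlocks A C D A)).pow_left k).mul_right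
      ((Commute.refl _).pow_left k) |>.eq, hsq, sub_mul, one_mul, mul_assoc, ← pow_succ']
  rw [hpow]
  generalize fromBlocks A C D A ^ (k + 1) = M
  generalize fromBlocks A C D A ^ k = N
  rw [← fromBlocks_toBlocks M, ← fromBlocks_toBlocks N, fromBlocks_multiply, sub_eq_add_neg,
    fromBlocks_neg, fromBlocks_add]
  simp [sub_eq_add_neg]

lemma cos_add_two_mul (k : ℕ) (t : ℝ) :
    Real.cos (((k + 2 : ℕ) : ℝ) * t) =
      2 * Real.cos t * Real.cos (((k + 1 : ℕ) : ℝ) * t) - Real.cos ((k : ℝ) * t) := by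
  have h₁ : ((k + 2 : ℕ) : ℝ) * t = ((k + 1 : ℕ) : ℝ) * t + t := by push_cast; ring
  have h₂ : (k : ℝ) * t = ((k + 1 : ℕ) : ℝ) * t - t := by push_cast; ring
  rw [h₁, h₂, Real.cos_add, Real.cos_sub]
  ring

/-- For the leapfrog iteration matrix
`𝒦 = [[I−(h²/2)B, hI], [−hB+(h³/4)B², I−(h²/2)B]]` with `B = Q diag(λ²) Qᵀ` s.p.d. and
`h²λᵢ² < 4`, the `(1,1)` block of `𝒦^L` has eigenvalues `cos(Lθᵢ)`,
`θᵢ = −cos⁻¹(1−(h²/2)λᵢ²)`: indeed `(𝒦^L)₁₁ = Q diag(cos(Lθᵢ)) Qᵀ`. -/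
theorem stmt_18 {d : ℕ} (B Q : Matrix (Fin d) (Fin d) ℝ)
    (lam2 : Fin d → ℝ)
    (hB : B.PosDef)
    (hQ : Qᵀ * Q = 1)
    (hBdiag : B = Q * Matrix.diagonal lam2 * Qᵀ)
    (hlam : ∀ i, 0 < lam2 i)
    (h : ℝ) (hh : 0 < h) (hsmall : ∀ i, h ^ 2 * lam2 i < 4)
    (L : ℕ) :
    ((Matrix.fromBlocks
        (1 - (h ^ 2 / 2) • B) (h • (1 : Matrix (Fin d) (Fin d) ℝ))
        (-(h • B) + (h ^ 3 / 4) • (B * B)) (1 - (h ^ 2 / 2) • B)) ^ L).toBlocks₁₁ =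
      Q * Matrix.diagonal
        (fun i => Real.cos ((L : ℝ) * (-Real.arccos (1 - h ^ 2 / 2 * lam2 i)))) * Qᵀ ∧
    ∀ i : Fin d, ∃ v : Fin d → ℝ, v ≠ 0 ∧
      ((Matrix.fromBlocks
          (1 - (h ^ 2 / 2) • B) (h • (1 : Matrix (Fin d) (Fin d) ℝ))
          (-(h • B) + (h ^ 3 / 4) • (B * B)) (1 - (h ^ 2 / 2) • B)) ^ L).toBlocks₁₁ *ᵥ v =
        Real.cos ((L : ℝ) * (-Real.arccos (1 - h ^ 2 / 2 * lam2 i))) • v := by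
  have hQ' : Q * Qᵀ = 1 := mul_eq_one_comm.mp hQ
  have hcos (i : Fin d) : Real.cos (-Real.arccos (1 - h ^ 2 / 2 * lam2 i)) =
      1 - h ^ 2 / 2 * lam2 i := by
    have := hsmall i
    have := mul_pos (pow_pos hh 2) (hlam i)
    rw [Real.cos_neg, Real.cos_arccos] <;> linarith
  set θ : Fin d → ℝ := fun i => -Real.arccos (1 - h ^ 2 / 2 * lam2 i)
  have hA : 1 - (h ^ 2 / 2) • B = Q * diagonal (fun i => Real.cos (θ i)) * Qᵀ := by
    have : diagonal (fun i => Real.cos (θ i)) =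
        (1 : Matrix (Fin d) (Fin d) ℝ) - (h ^ 2 / 2) • diagonal lam2 := by
      rw [← diagonal_one, ← diagonal_smul, diagonal_sub]
      exact congrArg diagonal (funext hcos)
    rw [this, hBdiag, mul_sub, sub_mul, mul_one, hQ', mul_smul_comm, smul_mul_assoc]
  have hrec := toBlocks₁₁_fromBlocks_pow_add_two (1 - (h ^ 2 / 2) • B)
    (h • (1 : Matrix (Fin d) (Fin d) ℝ)) (-(h • B) + (h ^ 3 / 4) • (B * B))
    (by simp only [smul_mul_assoc, one_mul, sub_mul, mul_sub, mul_one, mul_smul_comm]; module)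
    (by simp only [smul_mul_assoc, one_mul, sub_mul, mul_sub, mul_one, mul_smul_comm]; module)
    (by simp)
    (by
      simp only [smul_mul_assoc, one_mul, sub_mul, mul_sub, mul_one, mul_smul_comm, add_mul,
        mul_add, neg_mul, mul_neg, mul_assoc]
      module)
  have hblock (k : ℕ) : ((fromBlocks
        (1 - (h ^ 2 / 2) • B) (h • (1 : Matrix (Fin d) (Fin d) ℝ))
        (-(h • B) + (h ^ 3 / 4) • (B * B)) (1 - (h ^ 2 / 2) • B)) ^ k).toBlocks₁₁ =
      Q * diagonal (fun i => Real.cos ((k : ℝ) * θ i)) * Qᵀ := by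
    induction k using Nat.twoStepInduction with
    | zero =>
      rw [pow_zero, ← fromBlocks_one, toBlocks_fromBlocks₁₁]
      simp [hQ']
    | one =>
      rw [pow_one, toBlocks_fromBlocks₁₁, hA]
      simp
    | more k ih₀ ih₁ =>
      have hdiag : diagonal (fun i => Real.cos (((k + 2 : ℕ) : ℝ) * θ i)) =
          2 * (diagonal (fun i => Real.cos (θ i)) *
            diagonal (fun i => Real.cos (((k + 1 : ℕ) : ℝ) * θ i))) -
          diagonal (fun i => Real.cos ((k : ℝ) * θ i)) := by
        rw [diagonal_mul_diagonal, two_mul, diagonal_add, diagonal_sub]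
        refine congrArg diagonal (funext fun i => ?_)
        rw [cos_add_two_mul]
        ring
      rw [hrec, ih₀, ih₁, hA, hdiag]
      generalize diagonal (fun i => Real.cos (θ i)) = X
      generalize diagonal (fun i => Real.cos (((k + 1 : ℕ) : ℝ) * θ i)) = Y
      have hXY : Q * X * Qᵀ * (Q * Y * Qᵀ) = Q * (X * Y) * Qᵀ := by
        calc Q * X * Qᵀ * (Q * Y * Qᵀ) = Q * X * (Qᵀ * Q) * Y * Qᵀ := by noncomm_ring
          _ = Q * (X * Y) * Qᵀ := by rw [hQ]; noncomm_ring
      rw [mul_assoc 2, hXY]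
      noncomm_ring
  refine ⟨hblock L, fun i => ⟨Q *ᵥ Pi.single i 1, fun h0 => ?_, ?_⟩⟩
  · have h1 : Qᵀ *ᵥ (Q *ᵥ Pi.single i (1 : ℝ)) = 0 := by rw [h0, mulVec_zero]
    rw [mulVec_mulVec, hQ, one_mulVec] at h1
    simpa using congrFun h1 i
  · rw [hblock L, mulVec_mulVec, mul_assoc, hQ, mul_one, ← mulVec_mulVec, ← mulVec_smul,
      diagonal_mulVec_single, ← Pi.single_smul, smul_eq_mul]

end AR1
end
end
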